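/- Let N be a positive integer, 0 < s < 1 with N > 2s, let α > -2s and 1 < p < (N + 2α + 2s)/(N - 2s). Then there is no measurable function u : ℝ^N → ℝ which is positive almost everywhere, locally bounded, belongs to L_{2s}, has |x|^α u(x)^p locally integrable, and is a distributional solution of (-Δ)^s u = |x|^α u^p on ℝ^N. -/

import Mathlib

open MeasureTheory Filter Set

set_option linter.unusedSectionVars false

namespace FracHenon

open EuclideanGeometry

section Kelvin

variable {E : Type*} [NormedAddCommGroup E] [InnerProductSpace ℝ E]

theorem norm_inversion_zero (l : ℝ) (x : E) : ‖inversion (0 : E) l x‖ = l ^ 2 / ‖x‖ := by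
  simpa using dist_inversion_center (0 : E) x l

theorem norm_inversion_sub_inversion {x y : E} (hx : x ≠ 0) (hy : y ≠ 0) (l : ℝ) :
    ‖inversion (0 : E) l x - inversion (0 : E) l y‖ = l ^ 2 / (‖x‖ * ‖y‖) * ‖x - y‖ := by
  simpa [dist_eq_norm] using dist_inversion_inversion hx hy l

theorem inversion_zero_ne_zero {l : ℝ} (hl : 0 < l) {x : E} (hx : x ≠ 0) :
    inversion (0 : E) l x ≠ 0 := by
  rw [Ne, inversion_eq_center hl.ne']
  exact hx

theorem norm_inversion_sub {x y : E} (hx : x ≠ 0) (hy : y ≠ 0) {l : ℝ} (hl : 0 < l) :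
    ‖inversion (0 : E) l x - y‖ = ‖y‖ / ‖x‖ * ‖x - inversion (0 : E) l y‖ := by
  have h := norm_inversion_sub_inversion hx (inversion_zero_ne_zero hl hy) l
  rw [inversion_inversion _ hl.ne', norm_inversion_zero] at h
  rw [h]
  have : ‖x‖ ≠ 0 := norm_ne_zero_iff.2 hx
  have : ‖y‖ ≠ 0 := norm_ne_zero_iff.2 hy
  field_simp

theorem sq_norm_sub_inversion {x y : E} (hy : y ≠ 0) {l : ℝ} (hl : 0 < l) :
    (‖y‖ / l * ‖x - inversion (0 : E) l y‖) ^ 2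
      = ‖x - y‖ ^ 2 + (l ^ 2 - ‖x‖ ^ 2) * (l ^ 2 - ‖y‖ ^ 2) / l ^ 2 := by
  have h0 : ‖y‖ ≠ 0 := norm_ne_zero_iff.2 hy
  have h1 : inversion (0 : E) l y = (l / ‖y‖) ^ 2 • y := by simp [inversion]
  rw [mul_pow, @norm_sub_sq_real, @norm_sub_sq_real, norm_inversion_zero, h1, inner_smul_right]
  field_simp
  ring

theorem abs_det_fderiv_inversion [FiniteDimensional ℝ E] (l : ℝ) (x : E) :
    |((l / ‖x‖) ^ 2 • (((ℝ ∙ x)ᗮ.reflection : E ≃L[ℝ] E) : E →L[ℝ] E)).det|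
      = (l / ‖x‖) ^ (2 * Module.finrank ℝ E) := by
  have h : ((((ℝ ∙ x)ᗮ.reflection : E ≃L[ℝ] E) : E →L[ℝ] E)).det
      = (-1) ^ Module.finrank ℝ ((ℝ ∙ x)ᗮ)ᗮ :=
    Submodule.det_reflection _
  rw [ContinuousLinearMap.det] at h ⊢
  rw [ContinuousLinearMap.toLinearMap_smul, LinearMap.det_smul, h, abs_mul, abs_pow, abs_pow, abs_pow]
  simp [pow_mul, sq_abs]

variable [FiniteDimensional ℝ E] [MeasurableSpace E] [BorelSpace E]

theorem lintegral_eq_ball_add_inversion [Nontrivial E] {l : ℝ} (hl : 0 < l) (h : E → ENNReal) :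
    ∫⁻ y, h y = (∫⁻ y in Metric.ball (0 : E) l, h y) +
      ∫⁻ y in Metric.ball (0 : E) l,
        ENNReal.ofReal ((l / ‖y‖) ^ (2 * Module.finrank ℝ E)) * h (inversion (0 : E) l y) := by
  have hm : MeasurableSet (Metric.ball (0 : E) l) := Metric.isOpen_ball.measurableSet
  have hm' : MeasurableSet (Metric.ball (0 : E) l \ {0}) := hm.diff (measurableSet_singleton 0)
  rw [← lintegral_add_compl h hm]
  congr 1
  have himg : (inversion (0 : E) l) '' (Metric.ball (0 : E) l \ {0}) = (Metric.closedBall (0:E) l)ᶜ := by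
    ext z
    constructor
    · rintro ⟨y, ⟨hy, hy0⟩, rfl⟩
      have h0 : 0 < ‖y‖ := norm_pos_iff.2 hy0
      have : ‖y‖ < l := by simpa using hy
      simp only [mem_compl_iff, Metric.mem_closedBall, dist_zero_right, norm_inversion_zero, not_le]
      rw [lt_div_iff₀ h0]
      nlinarith
    · intro hz
      have hz : l < ‖z‖ := by simpa using hz
      have h0 : 0 < ‖z‖ := hl.trans hz
      have hz0 : z ≠ 0 := norm_pos_iff.1 h0
      refine ⟨inversion (0 : E) l z, ⟨?_, inversion_zero_ne_zero hl hz0⟩, inversion_inversion _ hl.ne' _⟩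
      simp only [Metric.mem_ball, dist_zero_right, norm_inversion_zero]
      rw [div_lt_iff₀ h0]
      nlinarith
  have key := lintegral_image_eq_lintegral_abs_det_fderiv_mul (volume : Measure E) hm'
    (f := inversion (0 : E) l)
    (f' := fun x => (l / ‖x‖) ^ 2 • (((ℝ ∙ x)ᗮ.reflection : E ≃L[ℝ] E) : E →L[ℝ] E))
    (fun x hx => by
      have := (hasFDerivAt_inversion (c := (0:E)) (R := l) (x := x) hx.2).hasFDerivWithinAt
        (s := Metric.ball (0 : E) l \ {0})
      simpa using this)
    ((inversion_injective (0 : E) hl.ne').injOn) h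
  simp only [abs_det_fderiv_inversion] at key
  have e1 : ∫⁻ y in (Metric.ball (0 : E) l)ᶜ, h y = ∫⁻ y in (Metric.closedBall (0 : E) l)ᶜ, h y := by
    apply setLIntegral_congr
    have hs : (Metric.sphere (0:E) l) =ᵐ[volume] (∅ : Set E) :=
      ae_eq_empty.2 (Measure.addHaar_sphere _ _ _)
    have : (Metric.ball (0 : E) l)ᶜ = (Metric.closedBall (0 : E) l)ᶜ ∪ Metric.sphere (0:E) l := by
      ext z
      simp only [mem_compl_iff, Metric.mem_ball, dist_zero_right, not_lt, Metric.mem_closedBall,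
        not_le, mem_union, mem_sphere_iff_norm, sub_zero]
      rw [le_iff_lt_or_eq, @eq_comm ℝ l]
    rw [this]
    simpa using (ae_eq_refl _).union hs
  rw [e1, ← himg, key]
  apply setLIntegral_congr
  have hs : ({0} : Set E) =ᵐ[volume] (∅ : Set E) := ae_eq_empty.2 (measure_singleton _)
  simpa using (ae_eq_refl _).diff hs

end Kelvin

section Kelvin

variable {E : Type*} [NormedAddCommGroup E] [InnerProductSpace ℝ E]

/-- The Kelvin transform of `v` with respect to the sphere of radius `l` about the origin. -/
noncomputable def kelvin (q : ℝ) (v : E → ℝ) (l : ℝ) (x : E) : ℝ :=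
  (l / ‖x‖) ^ q * v (inversion (0 : E) l x)

/-- The Riesz kernel reflected in the sphere of radius `l`. -/
noncomputable def reflKernel (q l : ℝ) (x y : E) : ℝ :=
  (l / ‖y‖) ^ q * ‖x - inversion (0 : E) l y‖ ^ (-q)

theorem kelvin_kelvin {q l : ℝ} (hl : 0 < l) (v : E → ℝ) {x : E} (hx : x ≠ 0) :
    kelvin q v l (inversion (0 : E) l x) = (l / ‖x‖) ^ (-q) * v x := by
  have h0 : 0 < ‖x‖ := norm_pos_iff.2 hx
  rw [kelvin, inversion_inversion _ hl.ne', norm_inversion_zero]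
  congr 1
  rw [Real.rpow_neg (by positivity), ← Real.inv_rpow (by positivity)]
  congr 1
  field_simp

theorem reflKernel_nonneg {q l : ℝ} (hl : 0 < l) (x y : E) : 0 ≤ reflKernel q l x y := by
  unfold reflKernel; positivity

theorem reflKernel_eq {q l : ℝ} (hl : 0 < l) (x : E) {y : E} (hy : y ≠ 0) :
    reflKernel q l x y = (‖y‖ / l * ‖x - inversion (0 : E) l y‖) ^ (-q) := by
  have h0 : 0 < ‖y‖ := norm_pos_iff.2 hy
  rw [reflKernel, Real.mul_rpow (by positivity) (by positivity)]
  congr 1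
  rw [Real.rpow_neg (by positivity), ← Real.inv_rpow (by positivity), inv_div]

theorem reflKernel_lt {q l : ℝ} (hq : 0 < q) (hl : 0 < l) {x y : E} (hy : y ≠ 0) (hxy : x ≠ y)
    (hxl : ‖x‖ < l) (hyl : ‖y‖ < l) : reflKernel q l x y < ‖x - y‖ ^ (-q) := by
  have h0 : 0 < ‖y‖ := norm_pos_iff.2 hy
  have h1 : 0 < ‖x - y‖ := norm_pos_iff.2 (sub_ne_zero.2 hxy)
  rw [reflKernel_eq hl x hy]
  apply Real.rpow_lt_rpow_of_neg h1 _ (by linarith)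
  apply lt_of_pow_lt_pow_left₀ 2 (by positivity)
  rw [sq_norm_sub_inversion hy hl]
  have : 0 < (l ^ 2 - ‖x‖ ^ 2) * (l ^ 2 - ‖y‖ ^ 2) / l ^ 2 := by
    have := norm_nonneg x
    have h2 : 0 < l ^ 2 - ‖x‖ ^ 2 := by nlinarith
    have h3 : 0 < l ^ 2 - ‖y‖ ^ 2 := by nlinarith
    positivity
  linarith

theorem mul_reflKernel_inversion_left {q l : ℝ} (hl : 0 < l) {x y : E} (hx : x ≠ 0) (hy : y ≠ 0) :
    (l / ‖x‖) ^ q * reflKernel q l (inversion (0 : E) l x) y = ‖x - y‖ ^ (-q) := by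
  have h0 : 0 < ‖y‖ := norm_pos_iff.2 hy
  have h1 : 0 < ‖x‖ := norm_pos_iff.2 hx
  rw [reflKernel, norm_inversion_sub_inversion hx hy, Real.mul_rpow (by positivity) (by positivity),
    ← mul_assoc, ← mul_assoc]
  conv_rhs => rw [← one_mul (‖x - y‖ ^ (-q))]
  congr 1
  rw [Real.rpow_neg (by positivity), ← Real.inv_rpow (by positivity),
    ← Real.mul_rpow (by positivity) (by positivity), ← Real.mul_rpow (by positivity) (by positivity)]
  have : l / ‖x‖ * (l / ‖y‖) * (l ^ 2 / (‖x‖ * ‖y‖))⁻¹ = 1 := by field_simp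
  rw [this, Real.one_rpow]

theorem mul_norm_inversion_sub_rpow {q l : ℝ} (hl : 0 < l) {x y : E} (hx : x ≠ 0) (hy : y ≠ 0) :
    (l / ‖x‖) ^ q * ‖inversion (0 : E) l x - y‖ ^ (-q) = reflKernel q l x y := by
  have h0 : 0 < ‖y‖ := norm_pos_iff.2 hy
  have h1 : 0 < ‖x‖ := norm_pos_iff.2 hx
  rw [reflKernel, norm_inversion_sub hx hy hl, Real.mul_rpow (by positivity) (by positivity),
    ← mul_assoc]
  congr 1
  rw [Real.rpow_neg (by positivity), ← Real.inv_rpow (by positivity),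
    ← Real.mul_rpow (by positivity) (by positivity)]
  congr 1
  field_simp

/-- The weight of the source term after a Kelvin transform. -/
theorem source_inversion {q l α p c m τ : ℝ} {k : ℕ} (hm : m = k) (hτ : τ = 2 * m - q + 2 * α - p * q)
    (hl : 0 < l) {v : E → ℝ} (hv : ∀ x, 0 < v x) (x : E) {y : E} (hy : y ≠ 0) :
    (l / ‖y‖) ^ (2 * k) * (‖x - inversion (0 : E) l y‖ ^ (-q) *
        (c * ‖inversion (0 : E) l y‖ ^ α * v (inversion (0 : E) l y) ^ p))
      = reflKernel q l x y * ((l / ‖y‖) ^ τ * (c * ‖y‖ ^ α * kelvin q v l y ^ p)) := by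
  have h0 : 0 < ‖y‖ := norm_pos_iff.2 hy
  have h1 : 0 < l / ‖y‖ := by positivity
  have e1 : ‖inversion (0 : E) l y‖ = (l / ‖y‖) ^ (2 : ℝ) * ‖y‖ := by
    rw [norm_inversion_zero, Real.rpow_two]
    field_simp
  have e2 : (l / ‖y‖) ^ (2 * k) = (l / ‖y‖) ^ (2 * m) := by
    rw [← Real.rpow_natCast]; congr 1; push_cast; rw [hm]
  rw [reflKernel, kelvin, e1, e2, Real.mul_rpow (by positivity) (by positivity),
    Real.mul_rpow (by positivity) (hv _).le, ← Real.rpow_mul h1.le, ← Real.rpow_mul h1.le]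
  have e3 : (l / ‖y‖) ^ (2 * m) * (l / ‖y‖) ^ (2 * α)
      = (l / ‖y‖) ^ q * (l / ‖y‖) ^ τ * (l / ‖y‖) ^ (q * p) := by
    rw [← Real.rpow_add h1, ← Real.rpow_add h1, ← Real.rpow_add h1]
    congr 1
    rw [hτ]; ring
  linear_combination (‖x - inversion (0 : E) l y‖ ^ (-q) * c * ‖y‖ ^ α *
    v (inversion (0 : E) l y) ^ p) * e3

variable [FiniteDimensional ℝ E] [MeasurableSpace E] [BorelSpace E] {q l α p c τ : ℝ} {v : E → ℝ}

theorem measurable_inversion_zero (l : ℝ) : Measurable (inversion (0 : E) l) := by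
  have : inversion (0 : E) l = fun x => (l / ‖x‖) ^ 2 • x := by ext x; simp [inversion]
  rw [this]
  fun_prop

theorem measurable_kelvin (hv : Measurable v) : Measurable (kelvin q v l) := by
  have h1 : Measurable fun x : E => (l / ‖x‖) ^ q := by fun_prop
  exact h1.mul (hv.comp (measurable_inversion_zero (E := E) l))

theorem measurable_reflKernel (x : E) : Measurable (reflKernel q l x) := by
  have := measurable_inversion_zero (E := E) l
  unfold reflKernel
  fun_prop

variable [Nontrivial E]

theorem potential_eq_setLIntegral_ball (hτ : τ = 2 * Module.finrank ℝ E - q + 2 * α - p * q) (hl : 0 < l)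
    (hc : 0 < c) (hvp : ∀ x, 0 < v x) (hvm : Measurable v)
    (hv : ∀ x, ENNReal.ofReal (v x) =
      ∫⁻ y, ENNReal.ofReal (‖x - y‖ ^ (-q) * (c * ‖y‖ ^ α * v y ^ p))) (x : E) :
    ENNReal.ofReal (v x) = ∫⁻ y in Metric.ball (0 : E) l,
      ENNReal.ofReal (‖x - y‖ ^ (-q) * (c * ‖y‖ ^ α * v y ^ p) +
        reflKernel q l x y * ((l / ‖y‖) ^ τ * (c * ‖y‖ ^ α * kelvin q v l y ^ p))) := by
  rw [hv x, lintegral_eq_ball_add_inversion hl, ← lintegral_add_left (by fun_prop)]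
  apply lintegral_congr_ae
  apply ae_restrict_of_ae
  filter_upwards [compl_mem_ae_iff.2 (measure_singleton (0 : E))] with y hy
  have hy : y ≠ 0 := hy
  rw [← ENNReal.ofReal_mul (by positivity), source_inversion rfl hτ hl hvp x hy]
  have h1 := fun x => (hvp x).le
  have h2 : 0 ≤ kelvin q v l y := mul_nonneg (by positivity) (h1 _)
  rw [ENNReal.ofReal_add]
  · exact mul_nonneg (by positivity) (mul_nonneg (by positivity) (Real.rpow_nonneg (h1 _) _))
  · exact mul_nonneg (reflKernel_nonneg hl _ _) (by positivity)

theorem kelvin_eq_setLIntegral_ball (hτ : τ = 2 * Module.finrank ℝ E - q + 2 * α - p * q) (hl : 0 < l)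
    (hc : 0 < c) (hvp : ∀ x, 0 < v x) (hvm : Measurable v)
    (hv : ∀ x, ENNReal.ofReal (v x) =
      ∫⁻ y, ENNReal.ofReal (‖x - y‖ ^ (-q) * (c * ‖y‖ ^ α * v y ^ p))) {x : E} (hx : x ≠ 0) :
    ENNReal.ofReal (kelvin q v l x) = ∫⁻ y in Metric.ball (0 : E) l,
      ENNReal.ofReal (reflKernel q l x y * (c * ‖y‖ ^ α * v y ^ p) +
        ‖x - y‖ ^ (-q) * ((l / ‖y‖) ^ τ * (c * ‖y‖ ^ α * kelvin q v l y ^ p))) := by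
  have h0 : 0 < ‖x‖ := norm_pos_iff.2 hx
  rw [kelvin, ENNReal.ofReal_mul (by positivity),
    potential_eq_setLIntegral_ball hτ hl hc hvp hvm hv, ← lintegral_const_mul']
  · apply lintegral_congr_ae
    apply ae_restrict_of_ae
    filter_upwards [compl_mem_ae_iff.2 (measure_singleton (0 : E))] with y hy
    have hy : y ≠ 0 := hy
    rw [← ENNReal.ofReal_mul (by positivity),
      ← mul_norm_inversion_sub_rpow hl hx hy, ← mul_reflKernel_inversion_left hl hx hy]
    ring_nf
  · exact ENNReal.ofReal_ne_top

end Kelvin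

section Singular

variable {E : Type*} [NormedAddCommGroup E] [InnerProductSpace ℝ E]
  [FiniteDimensional ℝ E] [MeasurableSpace E] [BorelSpace E] [Nontrivial E]

theorem integrableOn_norm_rpow_ball {e : ℝ} (he : -(Module.finrank ℝ E : ℝ) < e) (r : ℝ) :
    IntegrableOn (fun x : E => ‖x‖ ^ e) (Metric.ball 0 r) := by
  rcases le_or_gt r 0 with hr | hr
  · simp [Metric.ball_eq_empty.2 hr]
  rw [integrableOn_fun_norm_addHaar volume (f := fun t => t ^ e)]
  have h1 : IntegrableOn (fun t : ℝ => t ^ ((Module.finrank ℝ E : ℝ) - 1 + e)) (Ioo 0 r) :=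
    (intervalIntegral.integrableOn_Ioo_rpow_iff hr).2 (by linarith)
  refine h1.congr_fun (fun t ht => ?_) measurableSet_Ioo
  have : 1 ≤ Module.finrank ℝ E := Module.finrank_pos
  simp only [smul_eq_mul]
  rw [Real.rpow_add ht.1, ← Real.rpow_natCast, Nat.cast_sub this, Nat.cast_one]

theorem exists_forall_setLIntegral_rpow_le {e : ℝ} (he : -(Module.finrank ℝ E : ℝ) < e) (he0 : e ≤ 0)
    {η : ENNReal} (hη : η ≠ 0) :
    ∃ δ > (0 : ENNReal), ∀ D : Set E, MeasurableSet D → volume D < δ → ∀ x : E,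
      ∫⁻ y in D, ENNReal.ofReal (‖x - y‖ ^ e) ≤ η := by
  set h : E → ENNReal := (Metric.ball (0 : E) 1).indicator fun z => ENNReal.ofReal (‖z‖ ^ e) with hh
  have hfin : ∫⁻ z, h z ≠ ⊤ := by
    rw [hh, lintegral_indicator Metric.isOpen_ball.measurableSet]
    have := (integrableOn_norm_rpow_ball (E := E) he 1).hasFiniteIntegral
    rw [hasFiniteIntegral_iff_ofReal (ae_of_all _ fun x => by positivity)] at this
    exact this.ne
  have hη2 : η / 2 ≠ 0 := by simpa using hη
  obtain ⟨δ, hδ, H⟩ := exists_pos_setLIntegral_lt_of_measure_lt hfin hη2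
  refine ⟨min δ (η / 2), lt_min hδ (pos_iff_ne_zero.2 hη2), fun D hD hDv x => ?_⟩
  have hmh : Measurable h := by
    apply Measurable.indicator _ Metric.isOpen_ball.measurableSet
    fun_prop
  have hpt : ∀ y, ENNReal.ofReal (‖x - y‖ ^ e) ≤ h (y - x) + 1 := by
    intro y
    by_cases hy : y - x ∈ Metric.ball (0 : E) 1
    · rw [hh, indicator_of_mem hy, norm_sub_rev]
      exact le_self_add
    · have : 1 ≤ ‖x - y‖ := by rw [norm_sub_rev]; simpa using hy
      have : ‖x - y‖ ^ e ≤ 1 := Real.rpow_le_one_of_one_le_of_nonpos this he0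
      calc ENNReal.ofReal (‖x - y‖ ^ e) ≤ ENNReal.ofReal 1 := ENNReal.ofReal_le_ofReal this
        _ ≤ h (y - x) + 1 := by simp
  calc ∫⁻ y in D, ENNReal.ofReal (‖x - y‖ ^ e) ≤ ∫⁻ y in D, (h (y - x) + 1) :=
        lintegral_mono hpt
    _ = (∫⁻ y in D, h (y - x)) + volume D := by
        rw [lintegral_add_right _ measurable_const]; simp
    _ = (∫⁻ z in (fun z => z + x) ⁻¹' D, h z) + volume D := by
        congr 1
        rw [← lintegral_indicator hD, ← lintegral_indicator (hD.preimage (by fun_prop)),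
          ← lintegral_add_right_eq_self _ x]
        congr 1
        ext z
        by_cases hz : z + x ∈ D <;> simp [indicator, hz]
    _ ≤ η / 2 + η / 2 := by
        apply add_le_add
        · apply (H _ _).le
          rw [measure_preimage_add_right]
          exact hDv.trans_le (min_le_left _ _)
        · exact (hDv.trans_le (min_le_right _ _)).le
    _ = η := ENNReal.add_halves η

theorem rpow_mul_rpow_le {q α R a b : ℝ} (hq : 0 < q) (ha : 0 < a) (hb : 0 < b) (hbR : b ≤ R) :
    a ^ (-q) * b ^ α ≤ (R ^ α + 1) * (a ^ (min α 0 - q) + b ^ (min α 0 - q)) := by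
  have hR : 0 < R := hb.trans_le hbR
  have p1 : 0 < a ^ (min α 0 - q) := by positivity
  have p2 : 0 < b ^ (min α 0 - q) := by positivity
  have p3 : 0 < R ^ α := by positivity
  rcases le_or_gt 0 α with h | h
  · rw [min_eq_right h, zero_sub] at *
    have : b ^ α ≤ R ^ α := Real.rpow_le_rpow hb.le hbR h
    nlinarith [mul_le_mul_of_nonneg_left this p1.le]
  · rw [min_eq_left h.le] at *
    have : a ^ (-q) * b ^ α ≤ a ^ (α - q) + b ^ (α - q) := by
      rcases le_total a b with hab | hab
      · have h1 : b ^ α ≤ a ^ α := Real.rpow_le_rpow_of_nonpos ha hab h.le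
        have h2 : a ^ (α - q) = a ^ (-q) * a ^ α := by rw [← Real.rpow_add ha]; ring_nf
        nlinarith [Real.rpow_pos_of_pos ha (-q)]
      · have h1 : a ^ (-q) ≤ b ^ (-q) := Real.rpow_le_rpow_of_nonpos hb hab (by linarith)
        have h2 : b ^ (α - q) = b ^ (-q) * b ^ α := by rw [← Real.rpow_add hb]; ring_nf
        nlinarith [Real.rpow_pos_of_pos hb α]
    nlinarith

theorem exists_forall_setLIntegral_weight_le {q α : ℝ} (hq : 0 < q) (hqn : q < Module.finrank ℝ E)
    (hα : q - Module.finrank ℝ E < α) {R : ℝ} (hR : 0 < R) {η : ℝ} (hη : 0 < η) :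
    ∃ δ > (0 : ENNReal), ∀ D : Set E, MeasurableSet D → D ⊆ Metric.ball 0 R → volume D < δ → ∀ x : E,
      ∫⁻ y in D, ENNReal.ofReal (‖x - y‖ ^ (-q) * ‖y‖ ^ α) ≤ ENNReal.ofReal η := by
  have he : -(Module.finrank ℝ E : ℝ) < min α 0 - q := by
    rcases min_cases α 0 with h | h <;> linarith
  have he0 : min α 0 - q ≤ 0 := by have := min_le_right α 0; linarith
  have hK : 0 < R ^ α + 1 := by positivity
  have hη2 : ENNReal.ofReal (η / (R ^ α + 1) / 2) ≠ 0 := by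
    rw [Ne, ENNReal.ofReal_eq_zero, not_le]; positivity
  obtain ⟨δ, hδ, H⟩ := exists_forall_setLIntegral_rpow_le (E := E) he he0 hη2
  refine ⟨δ, hδ, fun D hD hDR hDv x => ?_⟩
  calc ∫⁻ y in D, ENNReal.ofReal (‖x - y‖ ^ (-q) * ‖y‖ ^ α)
      ≤ ∫⁻ y in D, ENNReal.ofReal (R ^ α + 1) * (ENNReal.ofReal (‖x - y‖ ^ (min α 0 - q)) +
          ENNReal.ofReal (‖0 - y‖ ^ (min α 0 - q))) := by
        apply lintegral_mono_ae
        rw [ae_restrict_iff' hD]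
        filter_upwards [compl_mem_ae_iff.2 (measure_singleton (0 : E)),
          compl_mem_ae_iff.2 (measure_singleton x)] with y hy hy' hyD
        rw [← ENNReal.ofReal_add (by positivity) (by positivity), ← ENNReal.ofReal_mul hK.le, zero_sub,
          norm_neg]
        apply ENNReal.ofReal_le_ofReal
        apply rpow_mul_rpow_le hq (norm_pos_iff.2 (sub_ne_zero.2 (Ne.symm hy'))) (norm_pos_iff.2 hy)
        simpa using (Metric.mem_ball.1 (hDR hyD)).le
    _ = ENNReal.ofReal (R ^ α + 1) * ((∫⁻ y in D, ENNReal.ofReal (‖x - y‖ ^ (min α 0 - q))) +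
          ∫⁻ y in D, ENNReal.ofReal (‖0 - y‖ ^ (min α 0 - q))) := by
        rw [lintegral_const_mul' _ _ ENNReal.ofReal_ne_top, lintegral_add_left (by fun_prop)]
    _ ≤ ENNReal.ofReal (R ^ α + 1) * (ENNReal.ofReal (η / (R ^ α + 1) / 2) +
          ENNReal.ofReal (η / (R ^ α + 1) / 2)) := by
        gcongr
        · exact H D hD hDv x
        · exact H D hD hDv 0
    _ = ENNReal.ofReal η := by
        rw [← ENNReal.ofReal_add (by positivity) (by positivity), ← ENNReal.ofReal_mul hK.le, add_halves]
        congr 1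
        field_simp

end Singular

section MovingSpheres

variable {E : Type*} [NormedAddCommGroup E] [InnerProductSpace ℝ E]
  [FiniteDimensional ℝ E] [MeasurableSpace E] [BorelSpace E]

/-- `v` is a positive, locally bounded, lower semicontinuous solution of the integral equation
`v = c |x|^(-q) * (|x|^α v^p)`. -/
structure IsPotential (q α p c : ℝ) (v : E → ℝ) : Prop where
  pos : ∀ x, 0 < v x
  measurable : Measurable v
  lsc : LowerSemicontinuous v
  bdd : ∀ R : ℝ, ∃ C : ℝ, ∀ x, ‖x‖ ≤ R → v x ≤ C
  eq : ∀ x, ENNReal.ofReal (v x) =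
      ∫⁻ y, ENNReal.ofReal (‖x - y‖ ^ (-q) * (c * ‖y‖ ^ α * v y ^ p))

/-- The set where the comparison `v ≤ kelvin q v l` fails in the punctured ball of radius `l`. -/
def badSet (q : ℝ) (v : E → ℝ) (l : ℝ) : Set E :=
  {y | y ∈ Metric.ball (0 : E) l ∧ y ≠ 0 ∧ kelvin q v l y < v y}

variable {q l α p c τ : ℝ} {v : E → ℝ}

theorem measurableSet_badSet (hv : Measurable v) : MeasurableSet (badSet q v l) := by
  have h1 : MeasurableSet {y : E | kelvin q v l y < v y} := measurableSet_lt (measurable_kelvin hv) hv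
  exact Metric.isOpen_ball.measurableSet.inter ((measurableSet_singleton (0 : E)).compl.inter h1)

theorem rpow_sub_rpow_le {a b p : ℝ} (ha : 0 < a) (hb : 0 ≤ b) (hp : 1 ≤ p) :
    a ^ p - b ^ p ≤ p * a ^ (p - 1) * (a - b) := by
  have h := one_add_mul_self_le_rpow_one_add (s := b / a - 1) (by
    have : 0 ≤ b / a := by positivity
    linarith) hp
  rw [add_sub_cancel, Real.div_rpow hb ha.le, le_div_iff₀ (by positivity)] at h
  have h2 : a ^ p = a ^ (p - 1) * a := by
    rw [← Real.rpow_add_one ha.ne']; ring_nf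
  have h3 : (1 + p * (b / a - 1)) * a ^ p = a ^ p + p * a ^ (p - 1) * (b - a) := by
    rw [h2]; field_simp
  linarith

theorem isOpen_setOf_lt_kelvin (hlsc : LowerSemicontinuous v) {z : E} (hz : z ≠ 0) :
    IsOpen {l : ℝ | 0 < l ∧ v z < kelvin q v l z} := by
  have hz0 : 0 < ‖z‖ := norm_pos_iff.2 hz
  rw [isOpen_iff_mem_nhds]
  rintro l ⟨hl, hlt⟩
  have ha : 0 < (l / ‖z‖) ^ q := by positivity
  have h1 : v z / (l / ‖z‖) ^ q < v (inversion (0 : E) l z) := by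
    rw [div_lt_iff₀ ha]; rwa [kelvin, mul_comm] at hlt
  obtain ⟨t, ht1, ht2⟩ := exists_between h1
  have hcont : Continuous fun r : ℝ => inversion (0 : E) r z := by
    have : (fun r : ℝ => inversion (0 : E) r z) = fun r => (r / ‖z‖) ^ 2 • z := by
      ext r; simp [inversion]
    rw [this]; fun_prop
  have e1 : ∀ᶠ r in nhds l, t < v (inversion (0 : E) r z) :=
    hcont.continuousAt.eventually (hlsc _ t ht2)
  have hb : ContinuousAt (fun r : ℝ => (r / ‖z‖) ^ q) l :=
    ContinuousAt.rpow_const (by fun_prop) (Or.inl (by positivity))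
  have hca : ContinuousAt (fun r : ℝ => v z / (r / ‖z‖) ^ q) l := continuousAt_const.div hb ha.ne'
  have e2 : ∀ᶠ r in nhds l, v z / (r / ‖z‖) ^ q < t := hca.eventually_lt continuousAt_const ht1
  filter_upwards [e1, e2, lt_mem_nhds hl] with r h1 h2 h3
  refine ⟨h3, ?_⟩
  have : 0 < (r / ‖z‖) ^ q := by positivity
  rw [div_lt_iff₀ this] at h2
  rw [kelvin]
  nlinarith

theorem source_lt_source_kelvin (hτ0 : 0 < τ) (hc : 0 < c) {y : E} (hy : y ≠ 0) (hyl : ‖y‖ < l) {a b : ℝ}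
    (ha : 0 < a) (hab : a ≤ b) (hp : 1 < p) :
    c * ‖y‖ ^ α * a ^ p < (l / ‖y‖) ^ τ * (c * ‖y‖ ^ α * b ^ p) := by
  have hy0 : 0 < ‖y‖ := norm_pos_iff.2 hy
  have h1 : 1 < (l / ‖y‖) ^ τ := Real.one_lt_rpow ((one_lt_div hy0).2 hyl) hτ0
  have h2 : a ^ p ≤ b ^ p := Real.rpow_le_rpow ha.le hab (by linarith)
  have h3 : 0 < a ^ p := by positivity
  have h4 : 0 < c * ‖y‖ ^ α := by positivity
  calc c * ‖y‖ ^ α * a ^ p ≤ c * ‖y‖ ^ α * b ^ p := by gcongr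
    _ = 1 * (c * ‖y‖ ^ α * b ^ p) := (one_mul _).symm
    _ < _ := by
      apply mul_lt_mul_of_pos_right h1
      exact mul_pos h4 (h3.trans_le h2)

theorem IsPotential.kelvin_pos (hP : IsPotential q α p c v) (hl : 0 < l) {y : E} (hy : y ≠ 0) :
    0 < kelvin q v l y := by
  have hy0 : 0 < ‖y‖ := norm_pos_iff.2 hy
  exact mul_pos (by positivity) (hP.pos _)

variable [Nontrivial E]

theorem IsPotential.lt_kelvin (hP : IsPotential q α p c v)
    (hτ : τ = 2 * Module.finrank ℝ E - q + 2 * α - p * q) (hq : 0 < q) (hp : 1 < p)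
    (hτ0 : 0 < τ) (hc : 0 < c) (hl : 0 < l) (h : ∀ y : E, y ≠ 0 → ‖y‖ < l → v y ≤ kelvin q v l y)
    {x : E} (hx : x ≠ 0) (hxl : ‖x‖ < l) : v x < kelvin q v l x := by
  rw [← ENNReal.ofReal_lt_ofReal_iff (hP.kelvin_pos hl hx),
    kelvin_eq_setLIntegral_ball hτ hl hc hP.pos hP.measurable hP.eq hx,
    potential_eq_setLIntegral_ball hτ hl hc hP.pos hP.measurable hP.eq x]
  have hk := measurable_kelvin (q := q) (l := l) hP.measurable
  have hv := hP.measurable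
  have hr := measurable_reflKernel (q := q) (l := l) x
  apply lintegral_strict_mono
  · rw [Ne, Measure.restrict_eq_zero]
    exact (Metric.measure_ball_pos volume 0 hl).ne'
  · fun_prop
  · rw [← potential_eq_setLIntegral_ball hτ hl hc hP.pos hP.measurable hP.eq x]
    exact ENNReal.ofReal_ne_top
  · rw [ae_restrict_iff' Metric.isOpen_ball.measurableSet]
    filter_upwards [compl_mem_ae_iff.2 (measure_singleton (0 : E)),
      compl_mem_ae_iff.2 (measure_singleton x)] with y hy hyx hyl
    have hyl : ‖y‖ < l := by simpa using hyl
    have h1 := reflKernel_lt hq hl hy (Ne.symm hyx) hxl hyl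
    have h2 := source_lt_source_kelvin (α := α) hτ0 hc hy hyl (hP.pos y) (h y hy hyl) hp
    have h3 := reflKernel_nonneg (q := q) hl x y
    have h4 : 0 ≤ c * ‖y‖ ^ α * v y ^ p := by have := hP.pos y; positivity
    rw [ENNReal.ofReal_lt_ofReal_iff_of_nonneg]
    · nlinarith
    · have := h4.trans h2.le
      positivity

theorem IsPotential.le_kelvin_add (hP : IsPotential q α p c v)
    (hτ : τ = 2 * Module.finrank ℝ E - q + 2 * α - p * q) (hq : 0 < q) (hp : 1 < p)
    (hτ0 : 0 < τ) (hc : 0 < c) (hl : 0 < l) {C M η : ℝ} (hC : 0 < C) (hM : 0 ≤ M) (hη : 0 ≤ η)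
    (hvC : ∀ y : E, ‖y‖ ≤ l → v y ≤ C) (h : ∀ y ∈ badSet q v l, v y - kelvin q v l y ≤ M)
    {x : E} (hx : x ≠ 0) (hxl : ‖x‖ < l)
    (hsmall : ∫⁻ y in badSet q v l, ENNReal.ofReal (‖x - y‖ ^ (-q) * ‖y‖ ^ α) ≤ ENNReal.ofReal η) :
    v x ≤ kelvin q v l x + c * p * C ^ (p - 1) * M * η := by
  have hD := measurableSet_badSet (q := q) (l := l) hP.measurable
  have hQ : 0 ≤ c * p * C ^ (p - 1) * M := by positivity
  have hkx := hP.kelvin_pos hl hx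
  have hk := measurable_kelvin (q := q) (l := l) hP.measurable
  have hv := hP.measurable
  have hr := measurable_reflKernel (q := q) (l := l) x
  rw [← ENNReal.ofReal_le_ofReal_iff (by positivity),
    ENNReal.ofReal_add hkx.le (by positivity),
    kelvin_eq_setLIntegral_ball hτ hl hc hP.pos hP.measurable hP.eq hx,
    potential_eq_setLIntegral_ball hτ hl hc hP.pos hP.measurable hP.eq x,
    ENNReal.ofReal_mul hQ]
  refine le_trans ?_ (add_le_add_right (mul_le_mul_right hsmall _) _)
  rw [← lintegral_const_mul' _ _ ENNReal.ofReal_ne_top, ← lintegral_indicator hD]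
  refine le_trans ?_ (add_le_add_right (setLIntegral_le_lintegral (Metric.ball (0 : E) l) _) _)
  rw [← lintegral_add_left (by fun_prop)]
  apply lintegral_mono_ae
  rw [ae_restrict_iff' Metric.isOpen_ball.measurableSet]
  filter_upwards [compl_mem_ae_iff.2 (measure_singleton (0 : E)),
      compl_mem_ae_iff.2 (measure_singleton x)] with y hy hyx hyl
  have hyl' : ‖y‖ < l := by simpa using hyl
  have hy0 : 0 < ‖y‖ := norm_pos_iff.2 hy
  have h1 := (reflKernel_lt hq hl hy (Ne.symm hyx) hxl hyl').le
  have h3 := reflKernel_nonneg (q := q) hl x y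
  have hvy := hP.pos y
  have hky := hP.kelvin_pos hl hy
  by_cases hyD : y ∈ badSet q v l
  · rw [indicator_of_mem hyD, ← ENNReal.ofReal_mul hQ, ← ENNReal.ofReal_add (by positivity) (by positivity)]
    apply ENNReal.ofReal_le_ofReal
    have e1 := (source_lt_source_kelvin (α := α) hτ0 hc hy hyl' hky le_rfl hp).le
    have e2 := rpow_sub_rpow_le hvy hky.le hp.le
    have e3 : v y ^ (p - 1) ≤ C ^ (p - 1) :=
      Real.rpow_le_rpow hvy.le (hvC y hyl'.le) (by linarith)
    have e4 : v y ^ p - kelvin q v l y ^ p ≤ p * C ^ (p - 1) * M := by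
      refine e2.trans ?_
      have := h y hyD
      have : 0 < v y - kelvin q v l y := sub_pos.2 hyD.2.2
      gcongr
    have e5 : c * ‖y‖ ^ α * v y ^ p - (l / ‖y‖) ^ τ * (c * ‖y‖ ^ α * kelvin q v l y ^ p)
        ≤ c * ‖y‖ ^ α * (p * C ^ (p - 1) * M) := by
      have : 0 < c * ‖y‖ ^ α := by positivity
      nlinarith
    have e6 : 0 ≤ c * ‖y‖ ^ α * (p * C ^ (p - 1) * M) := by positivity
    set k := ‖x - y‖ ^ (-q)
    set k' := reflKernel q l x y
    set F := c * ‖y‖ ^ α * v y ^ p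
    set F' := (l / ‖y‖) ^ τ * (c * ‖y‖ ^ α * kelvin q v l y ^ p)
    have e7 : (k - k') * (F - F') ≤ k * (c * ‖y‖ ^ α * (p * C ^ (p - 1) * M)) :=
      calc (k - k') * (F - F') ≤ (k - k') * (c * ‖y‖ ^ α * (p * C ^ (p - 1) * M)) :=
            mul_le_mul_of_nonneg_left e5 (by linarith)
        _ ≤ _ := mul_le_mul_of_nonneg_right (by linarith) e6
    linarith
  · rw [indicator_of_notMem hyD, add_zero]
    apply ENNReal.ofReal_le_ofReal
    have : v y ≤ kelvin q v l y := by
      by_contra hcon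
      exact hyD ⟨hyl, hy, not_le.1 hcon⟩
    have h2 := (source_lt_source_kelvin (α := α) hτ0 hc hy hyl' hvy this hp).le
    nlinarith

theorem IsPotential.exists_forall_badSet_eq_empty (hP : IsPotential q α p c v)
    (hτ : τ = 2 * Module.finrank ℝ E - q + 2 * α - p * q) (hq : 0 < q) (hqn : q < Module.finrank ℝ E)
    (hα : q - Module.finrank ℝ E < α) (hp : 1 < p) (hτ0 : 0 < τ) (hc : 0 < c) {R : ℝ} (hR : 0 < R) :
    ∃ δ > (0 : ENNReal), ∀ l, 0 < l → l ≤ R → volume (badSet q v l) < δ → badSet q v l = ∅ := by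
  obtain ⟨C, hC⟩ := hP.bdd R
  have hC0 : 0 < C := (hP.pos 0).trans_le (hC 0 (by simpa using hR.le))
  have hη : 0 < 1 / (2 * (c * p * C ^ (p - 1))) := by positivity
  obtain ⟨δ, hδ, H⟩ := exists_forall_setLIntegral_weight_le (E := E) hq hqn hα hR hη
  refine ⟨δ, hδ, fun l hl hlR hvol => ?_⟩
  have hD := measurableSet_badSet (q := q) (l := l) hP.measurable
  have hsub : badSet q v l ⊆ Metric.ball 0 R := fun y hy => Metric.ball_subset_ball hlR hy.1
  have key : ∀ k : ℕ, ∀ y ∈ badSet q v l, v y - kelvin q v l y ≤ C * (1 / 2) ^ k := by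
    intro k
    induction k with
    | zero =>
      intro y hy
      have h1 := hP.kelvin_pos (l := l) hl hy.2.1
      have h2 := hC y (by have := hsub hy; simp at this; exact this.le)
      simp; linarith
    | succ k ih =>
      intro y hy
      have := hP.le_kelvin_add hτ hq hp hτ0 hc hl hC0 (M := C * (1 / 2) ^ k) (by positivity) hη.le
        (fun y hy => hC y (hy.trans hlR)) ih hy.2.1 (by simpa using hy.1) (H _ hD hsub hvol y)
      have e : c * p * C ^ (p - 1) * (C * (1 / 2) ^ k) * (1 / (2 * (c * p * C ^ (p - 1))))
          = C * (1 / 2) ^ (k + 1) := by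
        field_simp
        ring
      rw [e] at this
      linarith
  rw [eq_empty_iff_forall_notMem]
  intro y hy
  have hlim : Tendsto (fun k : ℕ => C * (1 / 2 : ℝ) ^ k) atTop (nhds (C * 0)) :=
    (tendsto_pow_atTop_nhds_zero_of_lt_one (by norm_num) (by norm_num)).const_mul C
  have := ge_of_tendsto' hlim fun k => key k y hy
  have := hy.2.2
  linarith

end MovingSpheres

section LowerBound

variable {E : Type*} [NormedAddCommGroup E] [InnerProductSpace ℝ E]
  [FiniteDimensional ℝ E] [MeasurableSpace E] [BorelSpace E]

variable {q l α p c τ : ℝ} {v : E → ℝ}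

theorem badSet_eq_empty_iff (hl : 0 < l) :
    badSet q v l = ∅ ↔ ∀ z : E, l < ‖z‖ → kelvin q v l z ≤ v z := by
  rw [eq_empty_iff_forall_notMem]
  constructor
  · intro h z hz
    have hz0 : z ≠ 0 := norm_pos_iff.1 (hl.trans hz)
    have hzn : 0 < ‖z‖ := hl.trans hz
    have h1 := h (inversion (0 : E) l z)
    have h2 : kelvin q v l (inversion (0 : E) l z) ≥ v (inversion (0 : E) l z) := by
      by_contra hcon
      refine h1 ⟨?_, inversion_zero_ne_zero hl hz0, not_le.1 hcon⟩
      rw [mem_ball_zero_iff, norm_inversion_zero, div_lt_iff₀ hzn]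
      nlinarith
    rw [kelvin_kelvin hl v hz0] at h2
    have h3 : 0 < (l / ‖z‖) ^ q := by positivity
    rw [kelvin]
    calc (l / ‖z‖) ^ q * v (inversion (0 : E) l z)
        ≤ (l / ‖z‖) ^ q * ((l / ‖z‖) ^ (-q) * v z) := mul_le_mul_of_nonneg_left h2 h3.le
      _ = v z := by rw [Real.rpow_neg (by positivity)]; field_simp
  · rintro h y ⟨hyl, hy0, hy⟩
    have hyn : 0 < ‖y‖ := norm_pos_iff.2 hy0
    have hyl : ‖y‖ < l := by simpa using hyl
    have h1 := h (inversion (0 : E) l y) (by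
      rw [norm_inversion_zero, lt_div_iff₀ hyn]
      nlinarith)
    rw [kelvin_kelvin hl v hy0] at h1
    have h3 : 0 < (l / ‖y‖) ^ q := by positivity
    have : v y ≤ kelvin q v l y :=
      calc v y = (l / ‖y‖) ^ q * ((l / ‖y‖) ^ (-q) * v y) := by
            rw [Real.rpow_neg (by positivity)]; field_simp
        _ ≤ _ := mul_le_mul_of_nonneg_left h1 h3.le
    linarith

variable [Nontrivial E]

theorem IsPotential.tendsto_volume_badSet (hP : IsPotential q α p c v)
    (hτ : τ = 2 * Module.finrank ℝ E - q + 2 * α - p * q) (hq : 0 < q) (hp : 1 < p)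
    (hτ0 : 0 < τ) (hc : 0 < c) (hl : 0 < l) (h : badSet q v l = ∅) :
    Tendsto (fun r => volume (badSet q v r)) (nhdsWithin l (Ioi l)) (nhds 0) := by
  rw [← measure_empty (μ := (volume : Measure E))]
  have hlt : ∀ y : E, y ≠ 0 → ‖y‖ < l → v y < kelvin q v l y := by
    intro y hy hyl
    refine hP.lt_kelvin hτ hq hp hτ0 hc hl (fun z hz hzl => ?_) hy hyl
    by_contra hcon
    have : z ∈ badSet q v l := ⟨by simpa using hzl, hz, not_le.1 hcon⟩
    simp [h] at this
  refine tendsto_measure_of_ae_tendsto_indicator (nhdsWithin l (Ioi l)) MeasurableSet.empty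
    (fun r => measurableSet_badSet hP.measurable)
    (Metric.isOpen_ball (x := (0 : E)) (ε := l + 1)).measurableSet measure_ball_lt_top.ne ?_ ?_
  · have : ∀ᶠ r in nhdsWithin l (Ioi l), r < l + 1 :=
      nhdsWithin_le_nhds (gt_mem_nhds (by linarith))
    filter_upwards [this] with r hr y hy
    exact Metric.ball_subset_ball hr.le hy.1
  · have hsph : ∀ᵐ y : E, y ∉ Metric.sphere (0 : E) l :=
      compl_mem_ae_iff.2 (Measure.addHaar_sphere volume (0 : E) l)
    filter_upwards [hsph] with y hy
    simp only [mem_empty_iff_false, iff_false]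
    by_cases hy0 : y = 0
    · exact Eventually.of_forall fun r hr => hr.2.1 hy0
    rcases lt_trichotomy ‖y‖ l with h1 | h1 | h1
    · have := (isOpen_setOf_lt_kelvin (q := q) hP.lsc hy0).mem_nhds ⟨hl, hlt y hy0 h1⟩
      filter_upwards [nhdsWithin_le_nhds this] with r hr hbad
      exact lt_asymm hr.2 hbad.2.2
    · exact absurd (by simpa using h1) hy
    · filter_upwards [nhdsWithin_le_nhds (gt_mem_nhds h1)] with r hr hbad
      have := hbad.1
      rw [mem_ball_zero_iff] at this
      linarith

theorem IsPotential.badSet_eq_empty (hP : IsPotential q α p c v)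
    (hτ : τ = 2 * Module.finrank ℝ E - q + 2 * α - p * q) (hq : 0 < q) (hqn : q < Module.finrank ℝ E)
    (hα : q - Module.finrank ℝ E < α) (hp : 1 < p) (hτ0 : 0 < τ) (hc : 0 < c) (hl : 0 < l) :
    badSet q v l = ∅ := by
  obtain ⟨δ, hδ, H⟩ := hP.exists_forall_badSet_eq_empty hτ hq hqn hα hp hτ0 hc
    (show 0 < l + 1 by linarith)
  obtain ⟨a, ha0, hal, ha⟩ : ∃ a, 0 < a ∧ a ≤ l ∧ badSet q v a = ∅ := by
    have h1 : Tendsto (fun r : ℝ => volume (Metric.ball (0 : E) r)) (nhdsWithin 0 (Ioi 0)) (nhds 0) := by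
      have h2 : Tendsto (fun r : ℝ => ENNReal.ofReal (r ^ Module.finrank ℝ E) *
          volume (Metric.ball (0 : E) 1)) (nhds 0) (nhds (ENNReal.ofReal (0 ^ Module.finrank ℝ E) *
          volume (Metric.ball (0 : E) 1))) := by
        apply ENNReal.Tendsto.mul_const _ (Or.inr measure_ball_lt_top.ne)
        exact ENNReal.tendsto_ofReal ((continuous_pow _).tendsto 0)
      rw [zero_pow Module.finrank_pos.ne', ENNReal.ofReal_zero, zero_mul] at h2
      refine (h2.mono_left nhdsWithin_le_nhds).congr' ?_
      filter_upwards [self_mem_nhdsWithin] with r hr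
      rw [Measure.addHaar_ball volume (0 : E) (le_of_lt hr)]
    have h3 : ∀ᶠ r in nhdsWithin (0 : ℝ) (Ioi 0), r < l := nhdsWithin_le_nhds (gt_mem_nhds hl)
    obtain ⟨a, ⟨h4, h5⟩, h6⟩ := ((h1.eventually (gt_mem_nhds hδ)).and h3 |>.and
      self_mem_nhdsWithin).exists
    refine ⟨a, h6, h5.le, H a h6 (by linarith) ((measure_mono fun y hy => hy.1).trans_lt h4)⟩
  have hclosed : IsClosed ({r | badSet q v r = ∅} ∩ Icc a l) := by
    have : {r | badSet q v r = ∅} ∩ Icc a l = Icc a l ∩ ⋂ z : {z : E // z ≠ 0},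
        ({r : ℝ | r < ‖(z : E)‖} ∩ {r : ℝ | 0 < r ∧ v z < kelvin q v r z})ᶜ := by
      ext r
      rw [inter_comm]
      simp only [mem_inter_iff, and_congr_right_iff, mem_ofPred_eq, mem_iInter, mem_compl_iff]
      intro hr
      have hr0 : 0 < r := ha0.trans_le hr.1
      rw [badSet_eq_empty_iff hr0]
      constructor
      · rintro h z ⟨h1, _, h2⟩
        exact absurd (h z h1) (not_le.2 h2)
      · intro h z hz
        have := h ⟨z, norm_pos_iff.1 (hr0.trans hz)⟩
        by_contra hcon
        exact this ⟨hz, hr0, not_le.1 hcon⟩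
    rw [this]
    refine isClosed_Icc.inter (isClosed_iInter fun z => ?_)
    exact ((isOpen_Iio).inter (isOpen_setOf_lt_kelvin hP.lsc z.2)).isClosed_compl
  refine hclosed.Icc_subset_of_forall_mem_nhdsWithin ha (fun r hr => ?_) ⟨hal, le_rfl⟩
  have hr0 : 0 < r := ha0.trans_le hr.2.1
  have h1 := hP.tendsto_volume_badSet hτ hq hp hτ0 hc hr0 hr.1
  have h2 : ∀ᶠ t in nhdsWithin r (Ioi r), t < l := nhdsWithin_le_nhds (gt_mem_nhds hr.2.2)
  filter_upwards [h1.eventually (gt_mem_nhds hδ), h2, self_mem_nhdsWithin] with t ht1 ht2 ht3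
  exact H t (hr0.trans ht3) (by linarith) ht1

/-- Moving spheres: a potential decays at most like `|z|^(-q/2)`. -/
theorem IsPotential.exists_rpow_le (hP : IsPotential q α p c v)
    (hτ : τ = 2 * Module.finrank ℝ E - q + 2 * α - p * q) (hq : 0 < q) (hqn : q < Module.finrank ℝ E)
    (hα : q - Module.finrank ℝ E < α) (hp : 1 < p) (hτ0 : 0 < τ) (hc : 0 < c) :
    ∃ m > 0, ∀ z : E, 1 < ‖z‖ → m * ‖z‖ ^ (-(q / 2)) ≤ v z := by
  obtain ⟨x₀, hx₀, hmin⟩ := LowerSemicontinuousOn.exists_isMinOn (s := Metric.sphere (0 : E) 1)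
    (NormedSpace.sphere_nonempty.2 zero_le_one) (isCompact_sphere _ _) (hP.lsc.lowerSemicontinuousOn _)
  refine ⟨v x₀, hP.pos _, fun z hz => ?_⟩
  have hz0 : 0 < ‖z‖ := by linarith
  have hs : 0 < √‖z‖ := Real.sqrt_pos.2 hz0
  have hsz : √‖z‖ < ‖z‖ := (Real.sqrt_lt' hz0).2 (by nlinarith)
  have h1 := (badSet_eq_empty_iff hs).1 (hP.badSet_eq_empty hτ hq hqn hα hp hτ0 hc hs) z hsz
  refine le_trans ?_ h1
  have h2 : v x₀ ≤ v (inversion (0 : E) (√‖z‖) z) := hmin (by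
    rw [mem_sphere_zero_iff_norm, norm_inversion_zero, Real.sq_sqrt hz0.le, div_self hz0.ne'])
  have h3 : (√‖z‖ / ‖z‖) ^ q = ‖z‖ ^ (-(q / 2)) := by
    have : √‖z‖ / ‖z‖ = ‖z‖ ^ (-(1 / 2) : ℝ) := by
      rw [Real.sqrt_div_self', Real.sqrt_eq_rpow, Real.rpow_neg hz0.le, one_div]
    rw [this, ← Real.rpow_mul hz0.le]
    ring_nf
  rw [kelvin, h3, mul_comm]
  gcongr

end LowerBound

theorem two_mul_pow_sub_le {a b c : ℝ} (ha : 0 ≤ a) (hb : 0 ≤ b) (hc : 0 ≤ c) (m : ℕ) :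
    2 * a ^ (m + 1) - b ^ (m + 1) - c ^ (m + 1) ≤ (m + 1) * a ^ m * (2 * a - b - c) := by
  have key : ∀ b : ℝ, 0 ≤ b → a ^ (m + 1) - b ^ (m + 1) ≤ (m + 1) * a ^ m * (a - b) := by
    intro b hb
    rcases ha.eq_or_lt with rfl | ha
    · rcases Nat.eq_zero_or_pos m with rfl | hm
      · simp
      · simp [hm.ne']; positivity
    have h := one_add_mul_sub_le_pow (a := b / a) (n := m + 1)
      (by have : 0 ≤ b / a := by positivity
          linarith)
    rw [div_pow, le_div_iff₀ (by positivity)] at h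
    have e : (1 + ((m + 1 : ℕ) : ℝ) * (b / a - 1)) * a ^ (m + 1)
        = a ^ (m + 1) + (m + 1) * a ^ m * (b - a) := by
      push_cast; field_simp; ring
    rw [e] at h
    linarith
  have := key b hb
  have := key c hc
  linarith

section SecondDifference

variable {E : Type*} [NormedAddCommGroup E] [InnerProductSpace ℝ E]

theorem exists_forall_abs_second_difference_le (φ : SchwartzMap E ℝ) :
    ∃ C, 0 < C ∧ ∀ x z : E, |2 * φ x - φ (x + z) - φ (x - z)| ≤ C * min (‖z‖ ^ 2) 1 := by
  obtain ⟨C₀, h0⟩ := φ.decay 0 0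
  obtain ⟨C₂, h2⟩ := φ.decay 0 2
  have hC₀ : 0 < C₀ := h0.1
  have hC₂ : 0 < C₂ := h2.1
  have h0' : ∀ x, |φ x| ≤ C₀ := fun x => by simpa using h0.2 x
  have hd : ∀ x, ‖fderiv ℝ (fderiv ℝ φ) x‖ ≤ C₂ := fun x => by
    have := h2.2 x
    simpa [← norm_iteratedFDeriv_fderiv] using this
  have hφ : ContDiff ℝ 2 φ := φ.smooth 2
  have hφ' : Differentiable ℝ (fderiv ℝ φ) :=
    (hφ.fderiv_right (m := 1) (by norm_num)).differentiable (by norm_num)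
  have hφd : Differentiable ℝ φ := hφ.differentiable (by norm_num)
  have hlip : ∀ x y, ‖fderiv ℝ φ y - fderiv ℝ φ x‖ ≤ C₂ * ‖y - x‖ := fun x y =>
    convex_univ.norm_image_sub_le_of_norm_fderiv_le (fun w _ => hφ' w) (fun w _ => hd w)
      (mem_univ _) (mem_univ _)
  have hsq : ∀ x z, |2 * φ x - φ (x + z) - φ (x - z)| ≤ C₂ * ‖z‖ ^ 2 := by
    intro x z
    have hderiv : ∀ w, HasFDerivAt (fun w => φ (w + z) - φ w) (fderiv ℝ φ (w + z) - fderiv ℝ φ w) w :=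
      fun w => ((hasFDerivAt_comp_add_right z).2 (hφd _).hasFDerivAt).sub (hφd w).hasFDerivAt
    have := convex_univ.norm_image_sub_le_of_norm_hasFDerivWithin_le
      (fun w _ => (hderiv w).hasFDerivWithinAt) (C := C₂ * ‖z‖)
      (fun w _ => by simpa using hlip w (w + z)) (mem_univ x) (mem_univ (x - z))
    simp only [sub_add_cancel, Real.norm_eq_abs] at this
    calc |2 * φ x - φ (x + z) - φ (x - z)| = |φ x - φ (x - z) - (φ (x + z) - φ x)| := by
          ring_nf
      _ ≤ _ := this
      _ = _ := by simp; ring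
  refine ⟨C₂ + 4 * C₀, by positivity, fun x z => ?_⟩
  rcases le_total (‖z‖ ^ 2) 1 with h | h
  · rw [min_eq_left h]
    refine (hsq x z).trans ?_
    gcongr
    linarith
  · rw [min_eq_right h]
    have a1 := abs_le.1 (h0' x)
    have a2 := abs_le.1 (h0' (x + z))
    have a3 := abs_le.1 (h0' (x - z))
    rw [abs_le]
    constructor <;> linarith

end SecondDifference

section FracLap

variable {E : Type*} [NormedAddCommGroup E] [InnerProductSpace ℝ E]
  [FiniteDimensional ℝ E] [MeasurableSpace E] [BorelSpace E]

/-- The fractional Laplacian (without normalising constant) as a second difference integral. -/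
noncomputable def fracLap (s : ℝ) (φ : E → ℝ) (x : E) : ℝ :=
  (1 / 2) * ∫ z : E, (2 * φ x - φ (x + z) - φ (x - z)) / ‖z‖ ^ ((Module.finrank ℝ E : ℝ) + 2 * s)

variable {s : ℝ}

theorem fracLap_comp_smul (φ : E → ℝ) {r : ℝ} (hr : 0 < r) (x : E) :
    fracLap s (fun y => φ (r • y)) x = r ^ (2 * s) * fracLap s φ (r • x) := by
  rw [fracLap, fracLap]
  have h := Measure.integral_comp_smul_of_nonneg (volume : Measure E)
    (fun z => (2 * φ (r • x) - φ (r • x + z) - φ (r • x - z)) /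
      ‖z‖ ^ ((Module.finrank ℝ E : ℝ) + 2 * s)) r (hR := hr.le)
  have e : ∀ z : E, (2 * φ (r • x) - φ (r • (x + z)) - φ (r • (x - z))) /
      ‖z‖ ^ ((Module.finrank ℝ E : ℝ) + 2 * s) = r ^ ((Module.finrank ℝ E : ℝ) + 2 * s) *
      ((2 * φ (r • x) - φ (r • x + r • z) - φ (r • x - r • z)) /
      ‖r • z‖ ^ ((Module.finrank ℝ E : ℝ) + 2 * s)) := by
    intro z
    rw [smul_add, smul_sub, norm_smul, Real.norm_of_nonneg hr.le,
      Real.mul_rpow hr.le (norm_nonneg _)]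
    have : r ^ ((Module.finrank ℝ E : ℝ) + 2 * s) ≠ 0 := by positivity
    field_simp
  simp_rw [e]
  rw [integral_const_mul, h, smul_eq_mul, Real.rpow_add hr, Real.rpow_natCast]
  have : r ^ Module.finrank ℝ E ≠ 0 := by positivity
  field_simp

variable [Nontrivial E]

theorem integrable_min_div_rpow (hs0 : 0 < s) (hs1 : s < 1) :
    Integrable fun z : E => min (‖z‖ ^ 2) 1 / ‖z‖ ^ ((Module.finrank ℝ E : ℝ) + 2 * s) := by
  have hn : 1 ≤ Module.finrank ℝ E := Module.finrank_pos
  rw [integrable_fun_norm_addHaar volume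
    (f := fun t => min (t ^ 2) 1 / t ^ ((Module.finrank ℝ E : ℝ) + 2 * s))]
  rw [← Ioc_union_Ioi_eq_Ioi zero_le_one, integrableOn_union]
  have hpow : ∀ t : ℝ, 0 < t → t ^ (Module.finrank ℝ E - 1) = t ^ ((Module.finrank ℝ E : ℝ) - 1) := by
    intro t ht
    rw [← Real.rpow_natCast, Nat.cast_sub hn, Nat.cast_one]
  constructor
  · have h1 : IntegrableOn (fun t : ℝ => t ^ (1 - 2 * s)) (Ioc 0 1) :=
      (intervalIntegrable_iff_integrableOn_Ioc_of_le zero_le_one).1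
        (intervalIntegral.intervalIntegrable_rpow' (by linarith))
    refine h1.congr_fun (fun t ht => ?_) measurableSet_Ioc
    have h2 : min (t ^ 2) 1 = t ^ (2 : ℝ) := by
      rw [Real.rpow_two]
      exact min_eq_left (by nlinarith [ht.1, ht.2])
    simp only [smul_eq_mul]
    rw [h2, hpow t ht.1, ← Real.rpow_sub ht.1, ← Real.rpow_add ht.1]
    ring_nf
  · have h1 : IntegrableOn (fun t : ℝ => t ^ (-1 - 2 * s)) (Ioi 1) :=
      integrableOn_Ioi_rpow_of_lt (by linarith) zero_lt_one
    refine h1.congr_fun (fun t ht => ?_) measurableSet_Ioi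
    have ht : 1 < t := ht
    have h2 : min (t ^ 2) 1 = t ^ (0 : ℝ) := by
      rw [Real.rpow_zero]
      exact min_eq_right (by nlinarith)
    simp only [smul_eq_mul]
    rw [h2, hpow t (by linarith), ← Real.rpow_sub (by linarith), ← Real.rpow_add (by linarith)]
    ring_nf

theorem integrable_second_difference (hs0 : 0 < s) (hs1 : s < 1) (φ : SchwartzMap E ℝ) (x : E) :
    Integrable fun z : E => (2 * φ x - φ (x + z) - φ (x - z)) /
      ‖z‖ ^ ((Module.finrank ℝ E : ℝ) + 2 * s) := by
  obtain ⟨C, hC, h⟩ := exists_forall_abs_second_difference_le φ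
  refine ((integrable_min_div_rpow hs0 hs1).const_mul C).mono' ?_ (ae_of_all _ fun z => ?_)
  · have := φ.continuous
    apply Measurable.aestronglyMeasurable
    fun_prop
  · rw [norm_div, Real.norm_eq_abs, Real.norm_of_nonneg (by positivity), ← mul_div_assoc]
    gcongr
    exact h x z

theorem exists_forall_fracLap_le (hs0 : 0 < s) (hs1 : s < 1) (φ : SchwartzMap E ℝ) :
    ∃ C > 0, ∀ x, fracLap s φ x ≤ C := by
  obtain ⟨C, hC, h⟩ := exists_forall_abs_second_difference_le φ
  have hI := (integrable_min_div_rpow (E := E) hs0 hs1).const_mul C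
  refine ⟨(1 / 2) * (∫ z : E, C * (min (‖z‖ ^ 2) 1 / ‖z‖ ^ ((Module.finrank ℝ E : ℝ) + 2 * s))) + 1,
    by positivity, fun x => ?_⟩
  rw [fracLap]
  have := integral_mono (integrable_second_difference hs0 hs1 φ x) hI fun z => by
    simp only
    rw [← mul_div_assoc]
    gcongr
    exact (le_abs_self _).trans (h x z)
  linarith

theorem fracLap_pow_le (hs0 : 0 < s) (hs1 : s < 1) (φ ψ : SchwartzMap E ℝ) (hφ : ∀ x, 0 ≤ φ x) (m : ℕ)
    (hψ : ∀ x, ψ x = φ x ^ (m + 1)) (x : E) :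
    fracLap s ψ x ≤ (m + 1) * φ x ^ m * fracLap s φ x := by
  have h := integral_mono (integrable_second_difference hs0 hs1 ψ x)
    ((integrable_second_difference hs0 hs1 φ x).const_mul ((m + 1) * φ x ^ m)) fun z => by
      simp only [hψ]
      rw [← mul_div_assoc]
      gcongr
      exact two_mul_pow_sub_le (hφ _) (hφ _) (hφ _) m
  rw [integral_const_mul] at h
  rw [fracLap, fracLap]
  linarith

end FracLap

theorem mul_le_half_add {L a p t u w : ℝ} {m : ℕ} (hL : 0 < L) (ha : 0 < a) (hp : 1 < p)
    (hu : 0 < u) (hw : 0 ≤ w) (hw1 : w ≤ 1) (hm0 : m ≠ 0) (hm : 1 / (p - 1) ≤ m)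
    (ht : a ^ (-(1 / (p - 1))) ≤ t) :
    L * (u * w ^ m) ≤ 1 / 2 * (a * u ^ p * w ^ (m + 1)) + L * ((2 * L) ^ (1 / (p - 1)) * t) := by
  have ht0 : 0 ≤ t := le_trans (by positivity) ht
  have hp0 : 0 < p - 1 := by linarith
  rcases hw.eq_or_lt with rfl | hw
  · simp [hm0]; positivity
  rcases le_or_gt (L * (u * w ^ m)) (1 / 2 * (a * u ^ p * w ^ (m + 1))) with h | h
  · have : 0 ≤ L * ((2 * L) ^ (1 / (p - 1)) * t) := by positivity
    linarith
  have h1 : a * u ^ (p - 1) * w < 2 * L := by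
    have e : u ^ p = u ^ (p - 1) * u := by rw [← Real.rpow_add_one hu.ne']; ring_nf
    rw [e, pow_succ] at h
    have : 0 < u * w ^ m := by positivity
    by_contra hcon
    nlinarith [not_lt.1 hcon]
  have h2 : (a * u ^ (p - 1) * w) ^ (1 / (p - 1)) ≤ (2 * L) ^ (1 / (p - 1)) :=
    Real.rpow_le_rpow (by positivity) h1.le (by positivity)
  rw [Real.mul_rpow (by positivity) hw.le, Real.mul_rpow ha.le (by positivity),
    ← Real.rpow_mul hu.le, mul_one_div_cancel hp0.ne', Real.rpow_one] at h2
  have h3 : w ^ m ≤ w ^ (1 / (p - 1)) := by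
    rw [← Real.rpow_natCast]
    exact Real.rpow_le_rpow_of_exponent_ge hw hw1 hm
  have h4 : u * w ^ m ≤ (2 * L) ^ (1 / (p - 1)) * t := by
    calc u * w ^ m ≤ u * w ^ (1 / (p - 1)) := by gcongr
      _ = (a ^ (1 / (p - 1)) * u * w ^ (1 / (p - 1))) * a ^ (-(1 / (p - 1))) := by
        rw [Real.rpow_neg ha.le]
        field_simp
      _ ≤ _ := by gcongr
  have : 0 ≤ 1 / 2 * (a * u ^ p * w ^ (m + 1)) := by positivity
  have := mul_le_mul_of_nonneg_left h4 hL.le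
  linarith

section Caccioppoli

variable {E : Type*} [NormedAddCommGroup E] [InnerProductSpace ℝ E]
  [FiniteDimensional ℝ E] [MeasurableSpace E] [BorelSpace E]

/-- Positive, locally bounded distributional solutions of `(-Δ)^s u = |x|^α u^p`. -/
structure IsSolution (s α p : ℝ) (u : E → ℝ) : Prop where
  measurable : Measurable u
  pos : ∀ᵐ x, 0 < u x
  bdd : ∀ R : ℝ, ∃ C : ℝ, ∀ x, ‖x‖ ≤ R → |u x| ≤ C
  locInt : LocallyIntegrable fun x => ‖x‖ ^ α * u x ^ p
  weak : ∀ φ : SchwartzMap E ℝ, ∫ x, u x * fracLap s φ x = ∫ x, ‖x‖ ^ α * u x ^ p * φ x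

variable {s α p : ℝ} {u : E → ℝ}

theorem IsSolution.locallyIntegrable (hu : IsSolution s α p u) : LocallyIntegrable u := by
  rw [locallyIntegrable_iff]
  intro k hk
  obtain ⟨R, hR⟩ := hk.isBounded.exists_norm_le
  obtain ⟨C, hC⟩ := hu.bdd R
  refine IntegrableOn.of_bound hk.measure_lt_top hu.measurable.aestronglyMeasurable C ?_
  exact (ae_restrict_iff' hk.measurableSet).2 (ae_of_all _ fun x hx => hC x (hR x hx))

variable [Nontrivial E]

theorem exists_cutoff (hs0 : 0 < s) (hs1 : s < 1) (m : ℕ) :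
    ∃ C > 0, ∀ R : ℝ, 0 < R → ∃ φ ψ : SchwartzMap E ℝ, (∀ x, 0 ≤ φ x) ∧ (∀ x, φ x ≤ 1) ∧
      (∀ x, ‖x‖ ≤ R → φ x = 1) ∧ (∀ x, 2 * R ≤ ‖x‖ → φ x = 0) ∧ (∀ x, ψ x = φ x ^ (m + 1)) ∧
      ∀ x, fracLap s ψ x ≤ C * R ^ (-(2 * s)) * φ x ^ m := by
  let b : ContDiffBump (0 : E) := ⟨1, 2, by norm_num, by norm_num⟩
  have hb : ContDiff ℝ ((⊤ : ℕ∞) : WithTop ℕ∞) b := b.contDiff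
  obtain ⟨C, hC, h⟩ := exists_forall_fracLap_le hs0 hs1 (b.hasCompactSupport.toSchwartzMap hb)
  refine ⟨(m + 1) * C, by positivity, fun R hR => ?_⟩
  have hRi : 0 < R⁻¹ := by positivity
  have hφs : HasCompactSupport fun x : E => b (R⁻¹ • x) :=
    b.hasCompactSupport.comp_smul hRi.ne'
  have hφc : ContDiff ℝ ((⊤ : ℕ∞) : WithTop ℕ∞) fun x : E => b (R⁻¹ • x) :=
    hb.comp (contDiff_const_smul _)
  have hψs : HasCompactSupport fun x : E => b (R⁻¹ • x) ^ (m + 1) :=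
    hφs.comp_left (g := fun t => t ^ (m + 1)) (by simp)
  refine ⟨hφs.toSchwartzMap hφc, hψs.toSchwartzMap (hφc.pow (m + 1)), fun x => b.nonneg,
    fun x => b.le_one, fun x hx => ?_, fun x hx => ?_, fun x => rfl, fun x => ?_⟩
  · apply b.one_of_mem_closedBall
    rw [mem_closedBall_zero_iff, norm_smul, Real.norm_of_nonneg hRi.le]
    change R⁻¹ * ‖x‖ ≤ 1
    rw [inv_mul_le_iff₀ hR]; linarith
  · apply b.zero_of_le_dist
    rw [dist_zero_right, norm_smul, Real.norm_of_nonneg hRi.le]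
    change 2 ≤ R⁻¹ * ‖x‖
    rw [le_inv_mul_iff₀ hR]; linarith
  · refine (fracLap_pow_le hs0 hs1 (hφs.toSchwartzMap hφc) (hψs.toSchwartzMap (hφc.pow (m + 1)))
      (fun x => b.nonneg) m (fun x => rfl) x).trans ?_
    have e : fracLap s (hφs.toSchwartzMap hφc) x = (R⁻¹) ^ (2 * s) * fracLap s b (R⁻¹ • x) :=
      fracLap_comp_smul (fun y => b y) hRi x
    have h1 : fracLap s b (R⁻¹ • x) ≤ C := h _
    have h2 : 0 ≤ b (R⁻¹ • x) := b.nonneg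
    change (m + 1) * b (R⁻¹ • x) ^ m * fracLap s (hφs.toSchwartzMap hφc) x
      ≤ (m + 1) * C * R ^ (-(2 * s)) * b (R⁻¹ • x) ^ m
    rw [e, Real.inv_rpow hR.le, ← Real.rpow_neg hR.le]
    calc (m + 1) * b (R⁻¹ • x) ^ m * (R ^ (-(2 * s)) * fracLap s b (R⁻¹ • x))
        ≤ (m + 1) * b (R⁻¹ • x) ^ m * (R ^ (-(2 * s)) * C) := by gcongr
      _ = _ := by ring

open scoped Pointwise in
theorem setIntegral_norm_rpow_ball (e : ℝ) {r : ℝ} (hr : 0 < r) :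
    ∫ x in Metric.ball (0 : E) r, ‖x‖ ^ e =
      r ^ ((Module.finrank ℝ E : ℝ) + e) * ∫ x in Metric.ball (0 : E) 1, ‖x‖ ^ e := by
  have h := Measure.setIntegral_comp_smul_of_pos (volume : Measure E) (fun x => ‖x‖ ^ e)
    (Metric.ball (0 : E) 1) hr
  have h2 : r • Metric.ball (0 : E) 1 = Metric.ball 0 r := by
    rw [smul_ball hr.ne', smul_zero, Real.norm_of_nonneg hr.le, mul_one]
  rw [h2] at h
  simp_rw [norm_smul, Real.norm_of_nonneg hr.le, Real.mul_rpow hr.le (norm_nonneg _)] at h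
  rw [integral_const_mul, smul_eq_mul] at h
  rw [Real.rpow_add hr, Real.rpow_natCast, mul_assoc, h]
  field_simp

theorem IsSolution.exists_integral_le (hu : IsSolution s α p u) (hs0 : 0 < s) (hs1 : s < 1)
    (hp : 1 < p) {γ : ℝ} (hγ : γ < Module.finrank ℝ E) (hγα : γ ≤ α / (p - 1)) :
    ∃ C > 0, ∀ R : ℝ, 1 ≤ R →
      ∫ x in Metric.ball (0 : E) R, u x ≤
          C * (R ^ ((Module.finrank ℝ E : ℝ) - (2 * s / (p - 1) + γ)) + 1) ∧
      ∫ x in Metric.ball (0 : E) R, ‖x‖ ^ α * u x ^ p ≤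
          C * (R ^ ((Module.finrank ℝ E : ℝ) - (2 * s / (p - 1) + γ)) + 1) := by
  have hp0 : 0 < p - 1 := by linarith
  obtain ⟨m, hm⟩ := exists_nat_ge (1 / (p - 1))
  have hm0 : m ≠ 0 := by
    rintro rfl
    have : 0 < 1 / (p - 1) := by positivity
    simp at hm; linarith
  obtain ⟨C₁, hC₁, hcut⟩ := exists_cutoff (E := E) hs0 hs1 m
  obtain ⟨K, hK⟩ := hu.bdd 1
  have hK0 : 0 ≤ K := (abs_nonneg _).trans (hK 0 (by simp))
  set n : ℝ := (Module.finrank ℝ E : ℝ)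
  set I : ℝ := ∫ x in Metric.ball (0 : E) 1, ‖x‖ ^ (-γ)
  have hI : 0 ≤ I := integral_nonneg fun x => by positivity
  set V : ℝ := (volume : Measure E).real (Metric.ball (0 : E) 1)
  set A : ℝ := 2 * (2 * C₁) ^ (1 / (p - 1)) * 2 ^ (n - γ) * I
  have hA : 0 ≤ A := by positivity
  set C : ℝ := A + 2 * K * V + 1
  have hC : 0 < C := by positivity
  refine ⟨(1 + C₁) * C, by positivity, fun R hR => ?_⟩
  have hR0 : 0 < R := by linarith
  obtain ⟨φ, ψ, hφ0, hφ1, hφR, hφ2, hψ, hlap⟩ := hcut R hR0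
  set L := C₁ * R ^ (-(2 * s))
  have hL : 0 < L := by positivity
  have hLC : L ≤ C₁ := by
    have : R ^ (-(2 * s)) ≤ 1 := Real.rpow_le_one_of_one_le_of_nonpos hR (by linarith)
    nlinarith
  have hφs : HasCompactSupport φ := by
    refine HasCompactSupport.of_support_subset_isCompact (isCompact_closedBall (0 : E) (2 * R)) ?_
    intro x hx
    by_contra hcon
    exact hx (hφ2 x (by simp at hcon; linarith))
  have hφms : HasCompactSupport fun x => φ x ^ m :=
    hφs.comp_left (g := fun t : ℝ => t ^ m) (by simp [hm0])
  have hφm1s : HasCompactSupport fun x => φ x ^ (m + 1) :=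
    hφs.comp_left (g := fun t : ℝ => t ^ (m + 1)) (by simp)
  have hφc := φ.continuous
  have hY : Integrable fun x => u x * φ x ^ m := by
    simpa [mul_comm] using hu.locallyIntegrable.integrable_smul_left_of_hasCompactSupport
      (hφc.pow m) hφms
  have hX : Integrable fun x => ‖x‖ ^ α * u x ^ p * φ x ^ (m + 1) := by
    simpa [mul_comm] using hu.locInt.integrable_smul_left_of_hasCompactSupport
      (hφc.pow (m + 1)) hφm1s
  have hXY : ∫ x, ‖x‖ ^ α * u x ^ p * φ x ^ (m + 1) ≤ L * ∫ x, u x * φ x ^ m := by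
    have h1 := hu.weak ψ
    simp_rw [hψ] at h1
    rw [← h1]
    by_cases hintg : Integrable fun x => u x * fracLap s ψ x
    · rw [← integral_const_mul]
      refine integral_mono_ae hintg (hY.const_mul L) ?_
      filter_upwards [hu.pos] with x hx
      have := mul_le_mul_of_nonneg_left (hlap x) hx.le
      linarith
    · rw [integral_undef hintg]
      refine mul_nonneg hL.le (integral_nonneg_of_ae ?_)
      filter_upwards [hu.pos] with x hx
      exact mul_nonneg hx.le (pow_nonneg (hφ0 x) _)
  have hpt : ∀ᵐ x, L * (u x * φ x ^ m) ≤ 1 / 2 * (‖x‖ ^ α * u x ^ p * φ x ^ (m + 1)) +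
      (L * (2 * L) ^ (1 / (p - 1)) * (Metric.ball (0 : E) (2 * R)).indicator (fun x => ‖x‖ ^ (-γ)) x +
      L * K * (Metric.ball (0 : E) 1).indicator 1 x) := by
    filter_upwards [hu.pos] with x hx
    have hw0 := hφ0 x
    have hw1 := hφ1 x
    rcases lt_or_ge ‖x‖ 1 with h1 | h1
    · have e1 : x ∈ Metric.ball (0 : E) 1 := by simpa using h1
      have e2 : x ∈ Metric.ball (0 : E) (2 * R) := Metric.ball_subset_ball (by linarith) e1
      rw [indicator_of_mem e1, indicator_of_mem e2, Pi.one_apply, mul_one]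
      have h2 : u x * φ x ^ m ≤ K * 1 := by
        have := hK x h1.le
        have := le_abs_self (u x)
        have : φ x ^ m ≤ 1 := pow_le_one₀ hw0 hw1
        gcongr
        linarith
      have h3 : 0 ≤ 1 / 2 * (‖x‖ ^ α * u x ^ p * φ x ^ (m + 1)) +
        L * (2 * L) ^ (1 / (p - 1)) * ‖x‖ ^ (-γ) := by positivity
      nlinarith
    · have e1 : x ∉ Metric.ball (0 : E) 1 := by simpa using h1
      rw [indicator_of_notMem e1, mul_zero, add_zero]
      have hx0 : 0 < ‖x‖ := by linarith
      rcases lt_or_ge ‖x‖ (2 * R) with h2 | h2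
      · have e2 : x ∈ Metric.ball (0 : E) (2 * R) := by simpa using h2
        rw [indicator_of_mem e2, mul_assoc L]
        refine mul_le_half_add hL (by positivity) hp hx hw0 hw1 hm0 hm ?_
        rw [← Real.rpow_mul hx0.le]
        apply Real.rpow_le_rpow_of_exponent_le h1
        rw [mul_neg, mul_one_div]
        linarith
      · have e2 : x ∉ Metric.ball (0 : E) (2 * R) := by simpa using h2
        rw [indicator_of_notMem e2, hφ2 x h2]
        simp [hm0]
  have hi1 : Integrable ((Metric.ball (0 : E) (2 * R)).indicator (fun x => ‖x‖ ^ (-γ))) :=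
    (integrableOn_norm_rpow_ball (by simp only [n] at hγ ⊢; linarith) _).integrable_indicator
      Metric.isOpen_ball.measurableSet
  have hi2 : Integrable ((Metric.ball (0 : E) 1).indicator (1 : E → ℝ)) :=
    (integrable_indicator_iff Metric.isOpen_ball.measurableSet).2
      (integrableOn_const measure_ball_lt_top.ne)
  have hmain := integral_mono_ae (hY.const_mul L)
    ((hX.const_mul (1 / 2)).add ((hi1.const_mul _).add (hi2.const_mul _))) hpt
  rw [integral_const_mul, integral_add' (hX.const_mul (1 / 2)) ((hi1.const_mul _).add (hi2.const_mul _)),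
    integral_add' (hi1.const_mul _) (hi2.const_mul _),
    integral_const_mul, integral_const_mul, integral_const_mul,
    integral_indicator_one Metric.isOpen_ball.measurableSet,
    integral_indicator Metric.isOpen_ball.measurableSet,
    setIntegral_norm_rpow_ball _ (by positivity)] at hmain
  set Y := ∫ x, u x * φ x ^ m
  set X := ∫ x, ‖x‖ ^ α * u x ^ p * φ x ^ (m + 1)
  have hYle : Y ≤ C * (R ^ (n - (2 * s / (p - 1) + γ)) + 1) := by
    have e1 : (2 * L) ^ (1 / (p - 1)) * ((2 * R) ^ (n + -γ) * I)
        = A / 2 * R ^ (n - (2 * s / (p - 1) + γ)) := by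
      have : 2 * L = 2 * C₁ * R ^ (-(2 * s)) := by simp only [L]; ring
      rw [this, Real.mul_rpow (by positivity) (by positivity), ← Real.rpow_mul hR0.le,
        Real.mul_rpow (by norm_num) hR0.le]
      have : R ^ (n - (2 * s / (p - 1) + γ)) = R ^ (-(2 * s) * (1 / (p - 1))) * R ^ (n + -γ) := by
        rw [← Real.rpow_add hR0]; ring_nf
      rw [this]
      simp only [A, sub_eq_add_neg]
      ring
    have h2 : L * Y ≤ L * (2 * (A / 2 * R ^ (n - (2 * s / (p - 1) + γ)) + K * V)) := by
      rw [← e1]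
      linarith
    have h3 := le_of_mul_le_mul_left h2 hL
    have h4 : 0 < R ^ (n - (2 * s / (p - 1) + γ)) := by positivity
    have h5 : 0 ≤ K * V := by positivity
    simp only [C]
    nlinarith
  have hrhs : 0 ≤ C * (R ^ (n - (2 * s / (p - 1) + γ)) + 1) := by positivity
  constructor
  · have : ∫ x in Metric.ball (0 : E) R, u x ≤ Y := by
      rw [← integral_indicator Metric.isOpen_ball.measurableSet]
      refine integral_mono_of_nonneg ?_ hY ?_
      · filter_upwards [hu.pos] with x hx
        by_cases h : x ∈ Metric.ball (0 : E) R
        · rw [indicator_of_mem h]; exact hx.le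
        · rw [indicator_of_notMem h]; simp
      · filter_upwards [hu.pos] with x hx
        by_cases h : x ∈ Metric.ball (0 : E) R
        · rw [indicator_of_mem h, hφR x (by simpa using le_of_lt (mem_ball_zero_iff.1 h))]
          simp
        · rw [indicator_of_notMem h]
          have := hφ0 x
          positivity
    nlinarith
  · have : ∫ x in Metric.ball (0 : E) R, ‖x‖ ^ α * u x ^ p ≤ X := by
      rw [← integral_indicator Metric.isOpen_ball.measurableSet]
      refine integral_mono_of_nonneg ?_ hX ?_
      · filter_upwards [hu.pos] with x hx
        by_cases h : x ∈ Metric.ball (0 : E) R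
        · rw [indicator_of_mem h]; simp only [Pi.zero_apply]; positivity
        · rw [indicator_of_notMem h]; simp
      · filter_upwards [hu.pos] with x hx
        by_cases h : x ∈ Metric.ball (0 : E) R
        · rw [indicator_of_mem h, hφR x (by simpa using le_of_lt (mem_ball_zero_iff.1 h))]
          simp
        · rw [indicator_of_notMem h]
          have := hφ0 x
          positivity
    nlinarith
end Caccioppoli

section Weight

variable {E : Type*} [NormedAddCommGroup E] [MeasurableSpace E] [BorelSpace E]

theorem lintegral_Ioi_mul_rpow {k M : ℝ} (hk : 0 < k) (hM : 0 < M) :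
    ∫⁻ r in Ioi M, ENNReal.ofReal (k * r ^ (-k - 1)) = ENNReal.ofReal (M ^ (-k)) := by
  have hintg : IntegrableOn (fun r : ℝ => k * r ^ (-k - 1)) (Ioi M) :=
    (integrableOn_Ioi_rpow_of_lt (by linarith) hM).const_mul k
  rw [← ofReal_integral_eq_lintegral_ofReal hintg
    ((ae_restrict_iff' measurableSet_Ioi).2 (ae_of_all _ fun r hr => ?_))]
  · rw [integral_const_mul, integral_Ioi_rpow_of_lt (by linarith) hM]
    congr 1
    have : -k - 1 + 1 = -k := by ring
    rw [this]
    field_simp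
  · have : 0 < r := hM.trans hr
    simp only [Pi.zero_apply]
    positivity

theorem lintegral_mul_weight_lt_top (ν : Measure E) [SFinite ν] {g : E → ENNReal} (hg : Measurable g)
    {k μ C : ℝ} (hk : 0 < k) (hμ : 0 < μ)
    (h : ∀ R : ℝ, 1 ≤ R → ∫⁻ x in Metric.ball (0 : E) R, g x ∂ν ≤ ENNReal.ofReal (C * R ^ (k - μ))) :
    ∫⁻ x, g x * ENNReal.ofReal ((max 1 ‖x‖) ^ (-k)) ∂ν < ⊤ := by
  have hS : MeasurableSet {q : E × ℝ | max 1 ‖q.1‖ < q.2} :=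
    measurableSet_lt (by fun_prop) (by fun_prop)
  let F : E × ℝ → ENNReal := {q : E × ℝ | max 1 ‖q.1‖ < q.2}.indicator
    fun q => g q.1 * ENNReal.ofReal (k * q.2 ^ (-k - 1))
  have hF : Measurable F := by
    apply Measurable.indicator _ hS
    fun_prop
  have h1 : ∀ x, g x * ENNReal.ofReal ((max 1 ‖x‖) ^ (-k)) = ∫⁻ r, F (x, r) := by
    intro x
    rw [← lintegral_Ioi_mul_rpow hk (show 0 < max 1 ‖x‖ by positivity),
      ← lintegral_const_mul _ (by fun_prop), ← lintegral_indicator measurableSet_Ioi]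
    rfl
  simp_rw [h1]
  rw [lintegral_lintegral_swap (f := fun x r => F (x, r)) hF.aemeasurable]
  have h2 : ∀ r, ∫⁻ x, F (x, r) ∂ν ≤
      (Ioi (1 : ℝ)).indicator (fun r => ENNReal.ofReal (k * C * r ^ (-μ - 1))) r := by
    intro r
    by_cases hr : 1 < r
    · rw [indicator_of_mem (show r ∈ Ioi (1 : ℝ) from hr)]
      have hr0 : 0 < r := by linarith
      have e : ∀ x, F (x, r) = (Metric.ball (0 : E) r).indicator
          (fun x => ENNReal.ofReal (k * r ^ (-k - 1)) * g x) x := by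
        intro x
        by_cases hx : ‖x‖ < r
        · rw [indicator_of_mem (by simpa using hx)]
          simp only [F]
          rw [indicator_of_mem (show (x, r) ∈ {q : E × ℝ | max 1 ‖q.1‖ < q.2} from max_lt hr hx), mul_comm]
        · rw [indicator_of_notMem (by simpa using hx)]
          simp only [F]
          rw [indicator_of_notMem]
          intro hcon
          exact hx (lt_of_le_of_lt (le_max_right _ _) hcon)
      simp_rw [e]
      rw [lintegral_indicator Metric.isOpen_ball.measurableSet, lintegral_const_mul _ hg]
      refine (mul_le_mul_right (h r hr.le) _).trans_eq ?_
      rw [← ENNReal.ofReal_mul (by positivity)]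
      congr 1
      have : r ^ (-μ - 1) = r ^ (-k - 1) * r ^ (k - μ) := by
        rw [← Real.rpow_add hr0]; ring_nf
      rw [this]; ring
    · have : ∀ x, F (x, r) = 0 := fun x => by
        simp only [F]
        rw [indicator_of_notMem]
        intro hcon
        exact hr (lt_of_le_of_lt (le_max_left _ _) hcon)
      simp [this]
  refine (lintegral_mono h2).trans_lt ?_
  rw [lintegral_indicator measurableSet_Ioi]
  have hintg : IntegrableOn (fun r : ℝ => k * C * r ^ (-μ - 1)) (Ioi 1) :=
    (integrableOn_Ioi_rpow_of_lt (by linarith) one_pos).const_mul _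
  exact hintg.lintegral_lt_top

theorem max_one_norm_le (x₀ x : E) : max 1 ‖x‖ ≤ (1 + ‖x₀‖) * max 1 ‖x₀ - x‖ := by
  have h1 : ‖x‖ ≤ ‖x₀‖ + ‖x₀ - x‖ := by
    have := norm_sub_le x₀ (x₀ - x)
    simpa using this
  have h2 := le_max_left 1 ‖x₀ - x‖
  have h3 := le_max_right 1 ‖x₀ - x‖
  have h4 := norm_nonneg x₀
  apply max_le <;> nlinarith

theorem max_one_norm_sub_rpow_le {k : ℝ} (hk : 0 ≤ k) (x₀ x : E) :
    (max 1 ‖x₀ - x‖) ^ (-k) ≤ (1 + ‖x₀‖) ^ k * (max 1 ‖x‖) ^ (-k) := by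
  have h := Real.rpow_le_rpow (by positivity) (max_one_norm_le x₀ x) hk
  rw [Real.mul_rpow (by positivity) (by positivity)] at h
  rw [Real.rpow_neg (by positivity), Real.rpow_neg (by positivity), ← div_eq_mul_inv,
    inv_le_comm₀ (by positivity) (by positivity), inv_div, div_le_iff₀ (by positivity)]
  linarith

end Weight

section Decay

variable {E : Type*} [NormedAddCommGroup E] [InnerProductSpace ℝ E]
  [FiniteDimensional ℝ E] [MeasurableSpace E] [BorelSpace E] [Nontrivial E]
variable {s α p : ℝ} {u : E → ℝ}

/-- Averages over large balls of a solution and of its right-hand side decay faster than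
`R^(-(n-2s)/2)` in the subcritical range. -/
theorem IsSolution.exists_lintegral_ball_le (hu : IsSolution s α p u) (hs0 : 0 < s) (hs1 : s < 1)
    (hns : 2 * s < Module.finrank ℝ E) (hp : 1 < p)
    (hp2 : p < ((Module.finrank ℝ E : ℝ) + 2 * α + 2 * s) / (Module.finrank ℝ E - 2 * s)) :
    ∃ μ C : ℝ, ((Module.finrank ℝ E : ℝ) - 2 * s) / 2 < μ ∧ 0 < C ∧ ∀ R : ℝ, 1 ≤ R →
      ∫⁻ x in Metric.ball (0 : E) R, ENNReal.ofReal (u x) ≤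
        ENNReal.ofReal (C * R ^ ((Module.finrank ℝ E : ℝ) - μ)) ∧
      ∫⁻ x in Metric.ball (0 : E) R, ENNReal.ofReal (‖x‖ ^ α * u x ^ p) ≤
        ENNReal.ofReal (C * R ^ ((Module.finrank ℝ E : ℝ) - μ)) := by
  set n : ℝ := (Module.finrank ℝ E : ℝ)
  have hp0 : 0 < p - 1 := by linarith
  have hn0 : 0 < n - 2 * s := by linarith
  obtain ⟨C, hC, h⟩ := hu.exists_integral_le hs0 hs1 hp (γ := min (α / (p - 1)) (n - s))
    (lt_of_le_of_lt (min_le_right _ _) (by simp only [n]; linarith)) (min_le_left _ _)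
  set μ := 2 * s / (p - 1) + min (α / (p - 1)) (n - s)
  have hμ : (n - 2 * s) / 2 < μ := by
    have h0 : 0 < 2 * s / (p - 1) := by positivity
    rcases min_cases (α / (p - 1)) (n - s) with h | h
    · simp only [μ]
      rw [h.1, ← add_div, div_lt_div_iff₀ two_pos hp0]
      rw [lt_div_iff₀ hn0] at hp2
      nlinarith
    · simp only [μ]
      rw [h.1]
      linarith
  refine ⟨min μ n, 2 * C, lt_min hμ (by linarith), by positivity, fun R hR => ?_⟩
  have hR0 : 0 < R := by linarith
  have hle : C * (R ^ (n - μ) + 1) ≤ 2 * C * R ^ (n - min μ n) := by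
    have h1 : R ^ (n - μ) ≤ R ^ (n - min μ n) :=
      Real.rpow_le_rpow_of_exponent_le hR (by linarith [min_le_left μ n])
    have h2 : 1 ≤ R ^ (n - min μ n) :=
      Real.one_le_rpow hR (by linarith [min_le_right μ n])
    nlinarith
  have hb : Metric.ball (0 : E) R ⊆ Metric.closedBall 0 R := Metric.ball_subset_closedBall
  have i1 : IntegrableOn u (Metric.ball 0 R) :=
    (hu.locallyIntegrable.integrableOn_isCompact (isCompact_closedBall 0 R)).mono_set hb
  have i2 : IntegrableOn (fun x => ‖x‖ ^ α * u x ^ p) (Metric.ball 0 R) :=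
    (hu.locInt.integrableOn_isCompact (isCompact_closedBall 0 R)).mono_set hb
  constructor
  · rw [← ofReal_integral_eq_lintegral_ofReal i1 (ae_restrict_of_ae (hu.pos.mono fun x hx => hx.le))]
    exact ENNReal.ofReal_le_ofReal ((h R hR).1.trans hle)
  · rw [← ofReal_integral_eq_lintegral_ofReal i2 (ae_restrict_of_ae (hu.pos.mono fun x hx => by
      simp only [Pi.zero_apply]; positivity))]
    exact ENNReal.ofReal_le_ofReal ((h R hR).2.trans hle)

end Decay

section Heat

variable {E : Type*} [NormedAddCommGroup E] [InnerProductSpace ℝ E] [FiniteDimensional ℝ E]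
  [MeasurableSpace E] [BorelSpace E]

/-- The Gauss–Weierstrass heat kernel. -/
noncomputable def heat (t : ℝ) (x : E) : ℝ :=
  (4 * Real.pi * t) ^ (-((Module.finrank ℝ E : ℝ) / 2)) * Real.exp (-(‖x‖ ^ 2 / (4 * t)))

omit [FiniteDimensional ℝ E] [MeasurableSpace E] [BorelSpace E] in
theorem heat_pos {t : ℝ} (ht : 0 < t) (x : E) : 0 < heat t x := by
  unfold heat; positivity

omit [FiniteDimensional ℝ E] in
@[fun_prop]
theorem measurable_heat_uncurry : Measurable fun q : ℝ × E => heat q.1 q.2 := by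
  unfold heat; fun_prop

omit [FiniteDimensional ℝ E] [MeasurableSpace E] [BorelSpace E] in
theorem continuous_heat (t : ℝ) : Continuous (heat t : E → ℝ) := by
  unfold heat; fun_prop

omit [FiniteDimensional ℝ E] [MeasurableSpace E] [BorelSpace E] in
theorem heat_neg (t : ℝ) (x : E) : heat t (-x) = heat t x := by simp [heat]

theorem integrable_exp_neg_mul_norm_sq {b : ℝ} (hb : 0 < b) :
    Integrable fun x : E => Real.exp (-b * ‖x‖ ^ 2) := by
  apply Integrable.of_integral_ne_zero
  rw [GaussianFourier.integral_rexp_neg_mul_sq_norm hb]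
  positivity

omit [FiniteDimensional ℝ E] [MeasurableSpace E] [BorelSpace E] in
theorem heat_mul_heat {r t : ℝ} (hr : 0 < r) (ht : 0 < t) (x y : E) :
    heat r (x - y) * heat t y
      = (4 * Real.pi * r) ^ (-((Module.finrank ℝ E : ℝ) / 2))
        * (4 * Real.pi * t) ^ (-((Module.finrank ℝ E : ℝ) / 2))
        * Real.exp (-(‖x‖ ^ 2 / (4 * (r + t))))
        * Real.exp (-((r + t) / (4 * r * t)) * ‖y - (t / (r + t)) • x‖ ^ 2) := by
  have key : -(‖x - y‖ ^ 2 / (4 * r)) + -(‖y‖ ^ 2 / (4 * t))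
      = -(‖x‖ ^ 2 / (4 * (r + t))) + -((r + t) / (4 * r * t)) * ‖y - (t / (r + t)) • x‖ ^ 2 := by
    rw [norm_sub_sq_real, norm_sub_sq_real, norm_smul, inner_smul_right, real_inner_comm,
      mul_pow, Real.norm_eq_abs, sq_abs]
    field_simp
    ring
  unfold heat
  rw [mul_mul_mul_comm, ← Real.exp_add, key, Real.exp_add]
  ring

theorem integrable_heat_mul_heat {r t : ℝ} (hr : 0 < r) (ht : 0 < t) (x : E) :
    Integrable fun y => heat r (x - y) * heat t y := by
  simp_rw [heat_mul_heat hr ht]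
  exact ((integrable_exp_neg_mul_norm_sq (by positivity)).comp_sub_right _).const_mul _

theorem integral_heat_mul_heat {r t : ℝ} (hr : 0 < r) (ht : 0 < t) (x : E) :
    ∫ y, heat r (x - y) * heat t y = heat (r + t) x := by
  simp_rw [heat_mul_heat hr ht]
  rw [integral_const_mul, integral_sub_right_eq_self
    (fun y => Real.exp (-((r + t) / (4 * r * t)) * ‖y‖ ^ 2)),
    GaussianFourier.integral_rexp_neg_mul_sq_norm (by positivity)]
  unfold heat
  have hpi := Real.pi_pos
  rw [mul_right_comm]
  congr 1
  rw [Real.rpow_neg (by positivity), Real.rpow_neg (by positivity), Real.rpow_neg (by positivity),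
    ← mul_inv, ← Real.mul_rpow (by positivity) (by positivity), ← Real.inv_rpow (by positivity),
    ← Real.inv_rpow (by positivity), ← Real.mul_rpow (by positivity) (by positivity)]
  congr 1
  field_simp
  

theorem lintegral_heat_mul_heat {r t : ℝ} (hr : 0 < r) (ht : 0 < t) (x : E) :
    ∫⁻ y, ENNReal.ofReal (heat r (x - y) * heat t y) = ENNReal.ofReal (heat (r + t) x) := by
  rw [← integral_heat_mul_heat hr ht, ofReal_integral_eq_lintegral_ofReal
    (integrable_heat_mul_heat hr ht x)
    (ae_of_all _ fun y => (mul_pos (heat_pos hr _) (heat_pos ht _)).le)]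

theorem integrable_heat {t : ℝ} (ht : 0 < t) : Integrable (heat t : E → ℝ) := by
  have := (integrable_exp_neg_mul_norm_sq (E := E) (b := 1 / (4 * t)) (by positivity)).const_mul
    ((4 * Real.pi * t) ^ (-((Module.finrank ℝ E : ℝ) / 2)))
  refine this.congr (ae_of_all _ fun x => ?_)
  simp only [heat]
  congr 2
  ring

theorem integral_heat {t : ℝ} (ht : 0 < t) : ∫ x : E, heat t x = 1 := by
  have e : (heat t : E → ℝ) = fun x => (4 * Real.pi * t) ^ (-((Module.finrank ℝ E : ℝ) / 2))
      * Real.exp (-(1 / (4 * t)) * ‖x‖ ^ 2) := by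
    ext x
    simp only [heat]
    congr 2
    ring
  rw [e, integral_const_mul, GaussianFourier.integral_rexp_neg_mul_sq_norm (by positivity),
    Real.rpow_neg (by positivity)]
  have : Real.pi / (1 / (4 * t)) = 4 * Real.pi * t := by field_simp
  rw [this, inv_mul_cancel₀ (by positivity)]

end Heat

section Subordination

theorem integral_Ioi_rpow_mul_exp_neg_div {a b : ℝ} (ha : 0 < a) (hb : 0 < b) :
    ∫ σ in Ioi (0 : ℝ), σ ^ (-1 - a) * Real.exp (-(b / σ)) = (1 / b) ^ a * Real.Gamma a := by
  rw [← Real.integral_rpow_mul_exp_neg_mul_Ioi ha hb,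
    ← integral_comp_rpow_Ioi (fun t : ℝ => t ^ (a - 1) * Real.exp (-(b * t))) (p := -1) (by norm_num)]
  apply setIntegral_congr_fun measurableSet_Ioi
  intro σ hσ
  have hσ : 0 < σ := hσ
  simp only [smul_eq_mul, abs_neg, abs_one, one_mul]
  rw [← mul_assoc, ← Real.rpow_mul hσ.le, ← Real.rpow_add hσ, Real.rpow_neg_one]
  congr 2
  · ring
  

theorem lintegral_Ioi_rpow_mul_exp_neg_div {a b : ℝ} (ha : 0 < a) (hb : 0 < b) :
    ∫⁻ σ in Ioi (0 : ℝ), ENNReal.ofReal (σ ^ (-1 - a) * Real.exp (-(b / σ)))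
      = ENNReal.ofReal ((1 / b) ^ a * Real.Gamma a) := by
  have hG := Real.Gamma_pos_of_pos ha
  have hne : ∫ σ in Ioi (0 : ℝ), σ ^ (-1 - a) * Real.exp (-(b / σ)) ≠ 0 := by
    rw [integral_Ioi_rpow_mul_exp_neg_div ha hb]; positivity
  rw [← integral_Ioi_rpow_mul_exp_neg_div ha hb, ofReal_integral_eq_lintegral_ofReal
    (Integrable.of_integral_ne_zero hne)
    ((ae_restrict_iff' measurableSet_Ioi).2 (ae_of_all _ fun σ hσ => ?_))]
  have hσ : 0 < σ := hσ
  simp only [Pi.zero_apply]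
  positivity

variable {E : Type*} [NormedAddCommGroup E] [InnerProductSpace ℝ E]

/-- Heat-kernel representation of the homogeneous kernel of degree `2 * β - n`. -/
theorem exists_lintegral_rpow_mul_heat {β : ℝ} (hβ : 2 * β < Module.finrank ℝ E) :
    ∃ C, 0 < C ∧ ∀ x : E, x ≠ 0 →
      ∫⁻ σ in Ioi (0 : ℝ), ENNReal.ofReal (σ ^ (β - 1) * heat σ x)
        = ENNReal.ofReal (C * ‖x‖ ^ (2 * β - Module.finrank ℝ E)) := by
  set n : ℝ := (Module.finrank ℝ E : ℝ)
  have ha : 0 < n / 2 - β := by linarith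
  have hG := Real.Gamma_pos_of_pos ha
  have hpi := Real.pi_pos
  refine ⟨(4 * Real.pi) ^ (-(n / 2)) * (4 ^ (n / 2 - β) * Real.Gamma (n / 2 - β)), by positivity,
    fun x hx => ?_⟩
  have hx' : 0 < ‖x‖ := norm_pos_iff.2 hx
  have e : ∀ σ ∈ Ioi (0 : ℝ), ENNReal.ofReal (σ ^ (β - 1) * heat σ x)
      = ENNReal.ofReal ((4 * Real.pi) ^ (-(n / 2))) *
        ENNReal.ofReal (σ ^ (-1 - (n / 2 - β)) * Real.exp (-((‖x‖ ^ 2 / 4) / σ))) := by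
    intro σ hσ
    have hσ : 0 < σ := hσ
    rw [← ENNReal.ofReal_mul (by positivity)]
    congr 1
    unfold heat
    rw [Real.mul_rpow (by positivity) hσ.le,
      show -1 - (n / 2 - β) = (β - 1) + -(n / 2) by ring, Real.rpow_add hσ, div_div]
    ring
  rw [setLIntegral_congr_fun measurableSet_Ioi e, lintegral_const_mul' _ _ ENNReal.ofReal_ne_top,
    lintegral_Ioi_rpow_mul_exp_neg_div ha (by positivity), ← ENNReal.ofReal_mul (by positivity)]
  congr 1
  rw [one_div_div, Real.div_rpow (by positivity) (by positivity), ← Real.rpow_natCast ‖x‖ 2,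
    ← Real.rpow_mul hx'.le, show 2 * β - n = -(((2 : ℕ) : ℝ) * (n / 2 - β)) by push_cast; ring,
    Real.rpow_neg hx'.le]
  ring

end Subordination

section HeatSchwartz

variable {E : Type*} [NormedAddCommGroup E] [InnerProductSpace ℝ E]

theorem exists_schwartzMap_exp_neg_mul_norm_sq {b : ℝ} (hb : 0 < b) :
    ∃ φ : SchwartzMap E ℝ, ∀ x, φ x = Real.exp (-b * ‖x‖ ^ 2) := by
  have hf : (fun x : E => -b * ‖x‖ ^ 2).HasTemperateGrowth :=
    (Function.HasTemperateGrowth.const (-b)).mul (Function.hasTemperateGrowth_norm_sq E)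
  refine ⟨⟨fun x => Real.exp (-b * ‖x‖ ^ 2), Real.contDiff_exp.comp hf.1, fun k m => ?_⟩,
    fun x => rfl⟩
  obtain ⟨l, C, hC, h⟩ := hf.norm_iteratedFDeriv_le_uniform m
  set j := k + l * m
  refine ⟨m.factorial * (1 + C) ^ m * (j.factorial * Real.exp (2 * b) / b ^ j), fun x => ?_⟩
  have hx := norm_nonneg x
  have hpow : (1 + ‖x‖) ^ j ≤ j.factorial * Real.exp (2 * b) / b ^ j * Real.exp (b * ‖x‖ ^ 2) := by
    have h1 := Real.pow_div_factorial_le_exp (b * (2 + ‖x‖ ^ 2)) (by positivity) j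
    rw [div_le_iff₀ (by positivity), mul_pow, mul_add, Real.exp_add] at h1
    calc (1 + ‖x‖) ^ j ≤ (2 + ‖x‖ ^ 2) ^ j := by
          refine pow_le_pow_left₀ (by positivity) ?_ j
          nlinarith [sq_nonneg (‖x‖ - 1)]
      _ = b ^ j * (2 + ‖x‖ ^ 2) ^ j / b ^ j := by field_simp
      _ ≤ (Real.exp (b * 2) * Real.exp (b * ‖x‖ ^ 2) * j.factorial) / b ^ j := by gcongr
      _ = _ := by rw [mul_comm b 2]; ring
  have hD : 1 ≤ (1 + C) * (1 + ‖x‖) ^ l := by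
    have : 1 ≤ (1 + ‖x‖) ^ l := one_le_pow₀ (by linarith)
    nlinarith
  have hmain := norm_iteratedFDeriv_comp_le (n := m) (N := m) (x := x)
    (C := Real.exp (-b * ‖x‖ ^ 2)) (D := (1 + C) * (1 + ‖x‖) ^ l)
    (Real.contDiff_exp) (hf.1.of_le (by exact_mod_cast le_top)) le_rfl
    (fun i _ => by
      rw [norm_iteratedFDeriv_eq_norm_iteratedDeriv, iteratedDeriv_eq_iterate, Real.iter_deriv_exp,
        Real.norm_eq_abs, abs_of_pos (Real.exp_pos _)])
    (fun i hi1 hi => (h i hi x).trans <| by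
      calc C * (1 + ‖x‖) ^ l ≤ (1 + C) * (1 + ‖x‖) ^ l := by gcongr; linarith
        _ ≤ _ := le_self_pow₀ hD (by omega))
  calc ‖x‖ ^ k * ‖iteratedFDeriv ℝ m (fun x => Real.exp (-b * ‖x‖ ^ 2)) x‖
      ≤ (1 + ‖x‖) ^ k * (m.factorial * Real.exp (-b * ‖x‖ ^ 2) * ((1 + C) * (1 + ‖x‖) ^ l) ^ m) := by
        gcongr
        · linarith
        · exact hmain
    _ = m.factorial * (1 + C) ^ m * Real.exp (-b * ‖x‖ ^ 2) * (1 + ‖x‖) ^ j := by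
        rw [mul_pow, ← pow_mul, pow_add]; ring
    _ ≤ m.factorial * (1 + C) ^ m * Real.exp (-b * ‖x‖ ^ 2) *
        (j.factorial * Real.exp (2 * b) / b ^ j * Real.exp (b * ‖x‖ ^ 2)) := by gcongr
    _ = m.factorial * (1 + C) ^ m * (j.factorial * Real.exp (2 * b) / b ^ j) *
        (Real.exp (-b * ‖x‖ ^ 2) * Real.exp (b * ‖x‖ ^ 2)) := by ring
    _ = _ := by rw [← Real.exp_add]; simp

theorem exists_schwartzMap_heat {t : ℝ} (ht : 0 < t) (x₀ : E) :
    ∃ φ : SchwartzMap E ℝ, ∀ x, φ x = heat t (x₀ - x) := by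
  obtain ⟨φ, hφ⟩ := exists_schwartzMap_exp_neg_mul_norm_sq (E := E) (b := 1 / (4 * t)) (by positivity)
  have hg : (fun x : E => x₀ - x).HasTemperateGrowth :=
    (Function.HasTemperateGrowth.const x₀).sub .id
  have hg' : AntilipschitzWith 1 (fun x : E => x₀ - x) := by
    apply AntilipschitzWith.of_le_mul_dist
    intro x y
    simp [dist_eq_norm, norm_sub_rev]
  refine ⟨(4 * Real.pi * t) ^ (-((Module.finrank ℝ E : ℝ) / 2)) •
    SchwartzMap.compCLMOfAntilipschitz ℝ hg hg' φ, fun x => ?_⟩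
  simp only [smul_apply, SchwartzMap.compCLMOfAntilipschitz_apply, Function.comp, hφ,
    smul_eq_mul, heat]
  congr 2
  ring

/-- Schwartz functions decay faster than `(max 1 ‖x‖) ^ (-k)`. -/
theorem exists_abs_schwartzMap_le (φ : SchwartzMap E ℝ) (k : ℕ) :
    ∃ C, 0 < C ∧ ∀ x, |φ x| ≤ C * (max 1 ‖x‖) ^ (-(k : ℝ)) := by
  obtain ⟨C₀, h0, H0⟩ := φ.decay 0 0
  obtain ⟨C₁, h1, H1⟩ := φ.decay k 0
  refine ⟨C₀ + C₁, by positivity, fun x => ?_⟩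
  have H0 := H0 x
  have H1 := H1 x
  simp only [pow_zero, norm_iteratedFDeriv_zero, one_mul, Real.norm_eq_abs] at H0 H1
  rw [Real.rpow_neg (by positivity), Real.rpow_natCast, ← div_eq_mul_inv,
    le_div_iff₀ (by positivity)]
  rcases le_total ‖x‖ 1 with h | h
  · rw [max_eq_left h, one_pow, mul_one]; linarith
  · rw [max_eq_right h, mul_comm]; linarith

end HeatSchwartz

section HeatDeriv

variable {E : Type*} [NormedAddCommGroup E] [InnerProductSpace ℝ E]

/-- Minus the time derivative of the heat kernel. -/
noncomputable def heatD (σ : ℝ) (x : E) : ℝ :=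
  heat σ x * ((Module.finrank ℝ E : ℝ) / (2 * σ) - ‖x‖ ^ 2 / (4 * σ ^ 2))

theorem hasDerivAt_heat {σ : ℝ} (hσ : 0 < σ) (x : E) :
    HasDerivAt (fun σ => heat σ x) (-heatD σ x) σ := by
  have hpi := Real.pi_pos
  have h1 : HasDerivAt (fun σ : ℝ => (4 * Real.pi * σ) ^ (-((Module.finrank ℝ E : ℝ) / 2)))
      (4 * Real.pi * 1 * (-((Module.finrank ℝ E : ℝ) / 2)) *
        (4 * Real.pi * σ) ^ (-((Module.finrank ℝ E : ℝ) / 2) - 1)) σ :=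
    ((hasDerivAt_id σ).const_mul (4 * Real.pi)).rpow_const (Or.inl (by simp; positivity))
  have h2 : HasDerivAt (fun σ : ℝ => Real.exp (-(‖x‖ ^ 2 / (4 * σ))))
      (Real.exp (-(‖x‖ ^ 2 / (4 * σ))) * (-((0 * (4 * σ) - ‖x‖ ^ 2 * (4 * 1)) / (4 * σ) ^ 2))) σ :=
    (((hasDerivAt_const σ (‖x‖ ^ 2)).div ((hasDerivAt_id σ).const_mul 4)
      (by simp; positivity)).neg).exp
  refine (h1.mul h2).congr_deriv ?_
  unfold heatD heat
  rw [Real.rpow_sub_one (by positivity)]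
  field_simp
  ring

theorem exists_abs_heatD_le : ∃ K, 0 < K ∧ ∀ σ : ℝ, 0 < σ → ∀ x : E,
    |heatD σ x| ≤ K * (σ ^ (-1 - (Module.finrank ℝ E : ℝ) / 2) * Real.exp (-((‖x‖ ^ 2 / 8) / σ))) := by
  have hpi := Real.pi_pos
  refine ⟨(4 * Real.pi) ^ (-((Module.finrank ℝ E : ℝ) / 2)) * ((Module.finrank ℝ E : ℝ) / 2 + 2),
    by positivity, fun σ hσ x => ?_⟩
  set n : ℝ := (Module.finrank ℝ E : ℝ)
  have hn : 0 ≤ n := by positivity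
  set X := (‖x‖ ^ 2 / 8) / σ with hX
  have hX0 : 0 ≤ X := by positivity
  have e1 : ‖x‖ ^ 2 / (4 * σ) = X + X := by rw [hX]; field_simp; ring
  have e2 : n / (2 * σ) - ‖x‖ ^ 2 / (4 * σ ^ 2) = (n / 2 - 2 * X) / σ := by
    rw [hX]; field_simp; ring
  have hXe : X * Real.exp (-X) ≤ 1 := by
    rw [Real.exp_neg, ← div_eq_mul_inv, div_le_one (Real.exp_pos _)]
    linarith [Real.add_one_le_exp X]
  have hle : Real.exp (-X) ≤ 1 := by simpa using hX0
  unfold heatD heat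
  rw [e1, e2, neg_add, Real.exp_add, abs_mul, abs_of_pos (by positivity), abs_div, abs_of_pos hσ,
    Real.mul_rpow (by positivity) hσ.le, sub_eq_add_neg (-1 : ℝ), add_comm (-1 : ℝ), Real.rpow_add hσ,
    Real.rpow_neg_one]
  have h3 : |n / 2 - 2 * X| * Real.exp (-X) ≤ n / 2 + 2 := by
    have : |n / 2 - 2 * X| ≤ n / 2 + 2 * X := by
      rw [abs_le]; constructor <;> linarith
    calc _ ≤ (n / 2 + 2 * X) * Real.exp (-X) := by gcongr
      _ = n / 2 * Real.exp (-X) + 2 * (X * Real.exp (-X)) := by ring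
      _ ≤ n / 2 * 1 + 2 * 1 := by gcongr
      _ = _ := by ring
  calc _ = (4 * Real.pi) ^ (-(n / 2)) * (σ ^ (-(n / 2)) * σ⁻¹ * Real.exp (-X)) *
        (|n / 2 - 2 * X| * Real.exp (-X)) := by ring
    _ ≤ (4 * Real.pi) ^ (-(n / 2)) * (σ ^ (-(n / 2)) * σ⁻¹ * Real.exp (-X)) * (n / 2 + 2) := by gcongr
    _ = _ := by ring

theorem measurable_heatD_left (x : E) : Measurable fun σ : ℝ => heatD σ x := by
  unfold heatD heat; fun_prop

theorem exists_abs_heatD_le_rpow : ∃ K, 0 < K ∧ ∀ σ : ℝ, 0 < σ → ∀ x : E,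
    |heatD σ x| ≤ K * σ ^ (-1 - (Module.finrank ℝ E : ℝ) / 2) := by
  obtain ⟨K, hK, h⟩ := exists_abs_heatD_le (E := E)
  refine ⟨K, hK, fun σ hσ x => (h σ hσ x).trans ?_⟩
  gcongr
  apply mul_le_of_le_one_right (by positivity)
  rw [Real.exp_le_one_iff, neg_nonpos]
  positivity

theorem exists_lintegral_abs_heatD_le [FiniteDimensional ℝ E] [Nontrivial E] :
    ∃ C, 0 < C ∧ ∀ x : E, ∫⁻ σ in Ioi (1 : ℝ), ENNReal.ofReal |heatD σ x|
      ≤ ENNReal.ofReal (C * (max 1 ‖x‖) ^ (-(Module.finrank ℝ E : ℝ))) := by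
  obtain ⟨K, hK, h⟩ := exists_abs_heatD_le (E := E)
  obtain ⟨K', hK', h'⟩ := exists_abs_heatD_le_rpow (E := E)
  set n : ℝ := (Module.finrank ℝ E : ℝ) with hn
  have hn0 : 0 < n := by rw [hn]; exact_mod_cast Module.finrank_pos
  have hG := Real.Gamma_pos_of_pos (half_pos hn0)
  refine ⟨K' * (2 / n) + K * (8 ^ (n / 2) * Real.Gamma (n / 2)), by positivity, fun x => ?_⟩
  rcases le_total ‖x‖ 1 with hx | hx
  · rw [max_eq_left hx, Real.one_rpow, mul_one]
    have hintg : IntegrableOn (fun σ : ℝ => K' * σ ^ (-1 - n / 2)) (Ioi 1) :=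
      (integrableOn_Ioi_rpow_of_lt (by linarith) one_pos).const_mul _
    calc _ ≤ ∫⁻ σ in Ioi (1 : ℝ), ENNReal.ofReal (K' * σ ^ (-1 - n / 2)) :=
          setLIntegral_mono (by fun_prop) fun σ hσ =>
            ENNReal.ofReal_le_ofReal (h' σ (one_pos.trans hσ) x)
      _ = ENNReal.ofReal (K' * (2 / n)) := by
          rw [← ofReal_integral_eq_lintegral_ofReal hintg
            ((ae_restrict_iff' measurableSet_Ioi).2 (ae_of_all _ fun σ hσ => ?_))]
          · rw [integral_const_mul, integral_Ioi_rpow_of_lt (by linarith) one_pos, Real.one_rpow]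
            congr 2
            rw [show -1 - n / 2 + 1 = -(n / 2) by ring]
            field_simp
          · have : (0 : ℝ) < σ := one_pos.trans hσ
            simp only [Pi.zero_apply]; positivity
      _ ≤ _ := ENNReal.ofReal_le_ofReal (by linarith [show 0 ≤ K * (8 ^ (n / 2) * Real.Gamma (n / 2)) by positivity])
  · rw [max_eq_right hx]
    have hx0 : 0 < ‖x‖ := by linarith
    calc _ ≤ ∫⁻ σ in Ioi (0 : ℝ), ENNReal.ofReal |heatD σ x| :=
          lintegral_mono_set (Ioi_subset_Ioi zero_le_one)
      _ ≤ ∫⁻ σ in Ioi (0 : ℝ), ENNReal.ofReal K * ENNReal.ofReal (σ ^ (-1 - n / 2) * Real.exp (-((‖x‖ ^ 2 / 8) / σ))) := by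
          refine setLIntegral_mono (by fun_prop) fun σ hσ => ?_
          rw [← ENNReal.ofReal_mul hK.le]
          exact ENNReal.ofReal_le_ofReal (h σ hσ x)
      _ = ENNReal.ofReal (K * (8 ^ (n / 2) * Real.Gamma (n / 2)) * ‖x‖ ^ (-n)) := by
          rw [lintegral_const_mul' _ _ ENNReal.ofReal_ne_top,
            lintegral_Ioi_rpow_mul_exp_neg_div (by positivity) (by positivity), ← ENNReal.ofReal_mul hK.le]
          congr 1
          rw [one_div_div, Real.div_rpow (by positivity) (by positivity), ← Real.rpow_natCast ‖x‖ 2,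
            ← Real.rpow_mul hx0.le, show -n = -(((2 : ℕ) : ℝ) * (n / 2)) by push_cast; ring,
            Real.rpow_neg hx0.le]
          ring
      _ ≤ _ := by
          apply ENNReal.ofReal_le_ofReal
          gcongr
          linarith [show 0 ≤ K' * (2 / n) by positivity]

theorem tendsto_heat_atTop [FiniteDimensional ℝ E] [Nontrivial E] (x : E) :
    Tendsto (fun σ : ℝ => heat σ x) atTop (nhds 0) := by
  have hn0 : (0 : ℝ) < (Module.finrank ℝ E : ℝ) := by exact_mod_cast Module.finrank_pos
  have hpi := Real.pi_pos
  have h1 : Tendsto (fun σ : ℝ => (4 * Real.pi * σ) ^ (-((Module.finrank ℝ E : ℝ) / 2))) atTop (nhds 0) :=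
    (tendsto_rpow_neg_atTop (half_pos hn0)).comp (tendsto_id.const_mul_atTop (by positivity))
  refine squeeze_zero' ?_ ?_ h1
  · filter_upwards [eventually_gt_atTop 0] with σ hσ using (heat_pos hσ x).le
  · filter_upwards [eventually_gt_atTop 0] with σ hσ
    unfold heat
    apply mul_le_of_le_one_right (by positivity)
    rw [Real.exp_le_one_iff, neg_nonpos]
    positivity

theorem integrableOn_heatD [FiniteDimensional ℝ E] [Nontrivial E] {t : ℝ} (ht : 0 < t) (x : E) :
    IntegrableOn (fun σ => heatD σ x) (Ioi t) := by
  have hn0 : (0 : ℝ) < (Module.finrank ℝ E : ℝ) := by exact_mod_cast Module.finrank_pos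
  obtain ⟨K, hK, h⟩ := exists_abs_heatD_le_rpow (E := E)
  refine Integrable.mono' ((integrableOn_Ioi_rpow_of_lt (by linarith) ht).const_mul K)
    (measurable_heatD_left x).aestronglyMeasurable
    ((ae_restrict_iff' measurableSet_Ioi).2 (ae_of_all _ fun σ hσ => h σ (ht.trans hσ) x))

theorem integral_heatD_Ioi [FiniteDimensional ℝ E] [Nontrivial E] {t : ℝ} (ht : 0 < t) (x : E) :
    ∫ σ in Ioi t, heatD σ x = heat t x := by
  have := integral_Ioi_of_hasDerivAt_of_tendsto' (a := t)
    (fun σ hσ => hasDerivAt_heat (ht.trans_le hσ) x) (integrableOn_heatD ht x).neg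
    (tendsto_heat_atTop x)
  rw [integral_neg] at this
  linarith

theorem integral_heatD_Ioc [FiniteDimensional ℝ E] [Nontrivial E] {t r : ℝ} (ht : 0 < t)
    (hr : 0 ≤ r) (x : E) :
    ∫ σ in Ioc t (t + r), heatD σ x = heat t x - heat (t + r) x := by
  rw [← integral_heatD_Ioi ht x, ← integral_heatD_Ioi (by positivity : 0 < t + r) x,
    ← Ioc_union_Ioi_eq_Ioi (show t ≤ t + r by linarith), setIntegral_union (t := Ioi (t + r))
      (Set.disjoint_left.2 fun y hy hy' => not_lt.2 hy.2 hy') measurableSet_Ioi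
      ((integrableOn_heatD ht x).mono_set Ioc_subset_Ioi_self)
      (integrableOn_heatD (by positivity) x)]
  ring

end HeatDeriv

section FracLapHeat

variable {E : Type*} [NormedAddCommGroup E] [InnerProductSpace ℝ E] [FiniteDimensional ℝ E]
  [MeasurableSpace E] [BorelSpace E] [Nontrivial E] {s : ℝ}

theorem exists_fracLap_heat_eq (hs0 : 0 < s) (hs1 : s < 1) :
    ∃ C, 0 < C ∧ ∀ t, 0 < t → ∀ x₀ x : E, fracLap s (fun y => heat t (x₀ - y)) x
      = C * ∫ r in Ioi (0 : ℝ), r ^ (-s - 1) * (heat t (x₀ - x) - heat (t + r) (x₀ - x)) := by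
  set n : ℝ := (Module.finrank ℝ E : ℝ) with hn
  have hn0 : 0 < n := by rw [hn]; exact_mod_cast Module.finrank_pos
  obtain ⟨C, hC, hrep⟩ := exists_lintegral_rpow_mul_heat (E := E) (β := -s) (by linarith)
  refine ⟨C⁻¹, by positivity, fun t ht x₀ x => ?_⟩
  obtain ⟨φ, hφ⟩ := exists_schwartzMap_heat ht x₀
  have hφ' : (fun y => heat t (x₀ - y)) = φ := by ext y; rw [hφ]
  let G : E → ℝ := fun z => 2 * φ x - φ (x + z) - φ (x - z)
  have hGm : Measurable G := by
    have := φ.continuous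
    fun_prop
  have hker : ∀ z : E, z ≠ 0 → IntegrableOn (fun r : ℝ => r ^ (-s - 1) * heat r z) (Ioi 0) ∧
      ∫ r in Ioi (0 : ℝ), r ^ (-s - 1) * heat r z = C * (‖z‖ ^ (n + 2 * s))⁻¹ := by
    intro z hz
    have h1 := hrep z hz
    have hz' : 0 < ‖z‖ := norm_pos_iff.2 hz
    have hnn : 0 ≤ᵐ[volume.restrict (Ioi (0 : ℝ))] fun r : ℝ => r ^ (-s - 1) * heat r z :=
      (ae_restrict_iff' measurableSet_Ioi).2 (ae_of_all _ fun r hr => by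
        have hr : 0 < r := hr
        have := heat_pos hr z
        simp only [Pi.zero_apply]; positivity)
    have hm : Measurable fun r : ℝ => r ^ (-s - 1) * heat r z := by fun_prop
    constructor
    · refine ⟨hm.aestronglyMeasurable, ?_⟩
      rw [hasFiniteIntegral_iff_ofReal hnn, h1]
      exact ENNReal.ofReal_lt_top
    · rw [integral_eq_lintegral_of_nonneg_ae hnn hm.aestronglyMeasurable, h1,
        ENNReal.toReal_ofReal (by positivity), ← Real.rpow_neg hz'.le]
      congr 2
      ring
  have hne : ∀ᵐ z : E, z ≠ 0 := compl_mem_ae_iff.2 (measure_singleton _)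
  have hdiff := integrable_second_difference hs0 hs1 φ x
  have hF : Integrable (Function.uncurry fun (z : E) (r : ℝ) => G z * (r ^ (-s - 1) * heat r z))
      (volume.prod (volume.restrict (Ioi 0))) := by
    have hFm : Measurable (Function.uncurry fun (z : E) (r : ℝ) => G z * (r ^ (-s - 1) * heat r z)) := by
      apply (hGm.comp measurable_fst).mul
      apply (measurable_snd.pow_const _).mul
      exact measurable_heat_uncurry.comp measurable_swap
    rw [integrable_prod_iff hFm.aestronglyMeasurable]
    constructor
    · filter_upwards [hne] with z hz
      exact Integrable.const_mul (hker z hz).1 (G z)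
    · refine (hdiff.norm.const_mul C).congr ?_
      filter_upwards [hne] with z hz
      have : ∀ r ∈ Ioi (0 : ℝ), ‖Function.uncurry (fun (z : E) (r : ℝ) => G z * (r ^ (-s - 1) * heat r z)) (z, r)‖
          = |G z| * (r ^ (-s - 1) * heat r z) := by
        intro r hr
        have hr : 0 < r := hr
        have := heat_pos hr z
        simp only [Function.uncurry, Real.norm_eq_abs, abs_mul, abs_of_pos this]
        rw [abs_of_nonneg (a := r ^ (-s - 1)) (by positivity)]
      rw [setIntegral_congr_fun measurableSet_Ioi this, integral_const_mul, (hker z hz).2, norm_div,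
        Real.norm_eq_abs, Real.norm_of_nonneg (by positivity)]
      simp only [G]
      ring
  have hswap := integral_integral_swap hF
  have hl : ∫ z, ∫ r in Ioi (0 : ℝ), G z * (r ^ (-s - 1) * heat r z) = C * (2 * fracLap s φ x) := by
    rw [fracLap, ← mul_assoc 2, show (2 : ℝ) * (1 / 2) = 1 by norm_num, one_mul, ← integral_const_mul]
    apply integral_congr_ae
    filter_upwards [hne] with z hz
    rw [integral_const_mul, (hker z hz).2]
    simp only [G]
    ring
  have hr : ∀ r ∈ Ioi (0 : ℝ), ∫ z : E, G z * (r ^ (-s - 1) * heat r z)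
      = 2 * (r ^ (-s - 1) * (heat t (x₀ - x) - heat (t + r) (x₀ - x))) := by
    intro r hr
    have hr : 0 < r := hr
    have i1 : Integrable fun z : E => heat t ((x₀ - x) - z) * heat r z :=
      integrable_heat_mul_heat ht hr _
    have i2 : Integrable fun z : E => heat t ((x₀ - x) + z) * heat r z := by
      have := i1.comp_neg
      simpa [heat_neg] using this
    have e2 : ∫ z : E, heat t ((x₀ - x) + z) * heat r z = heat (t + r) (x₀ - x) := by
      rw [← integral_heat_mul_heat ht hr, ← integral_neg_eq_self]
      simp [heat_neg, sub_eq_add_neg]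
    have e : ∀ z : E, G z * (r ^ (-s - 1) * heat r z) = r ^ (-s - 1) *
        (2 * heat t (x₀ - x) * heat r z - heat t ((x₀ - x) - z) * heat r z
          - heat t ((x₀ - x) + z) * heat r z) := by
      intro z
      simp only [G, hφ]
      rw [show x₀ - (x + z) = x₀ - x - z by abel, show x₀ - (x - z) = x₀ - x + z by abel]
      ring
    have i0 := (integrable_heat (E := E) hr).const_mul (2 * heat t (x₀ - x))
    simp_rw [e]
    rw [integral_const_mul, integral_sub (by exact i0.sub i1) i2, integral_sub i0 i1, integral_const_mul,
      integral_heat hr, integral_heat_mul_heat ht hr, e2]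
    ring
  rw [hφ', eq_inv_mul_iff_mul_eq₀ hC.ne']
  rw [hl, setIntegral_congr_fun measurableSet_Ioi hr, integral_const_mul] at hswap
  linarith

omit [MeasurableSpace E] [BorelSpace E] in
theorem integrableOn_rpow_mul_heatD (hs0 : 0 < s) (hs1 : s < 1) {t : ℝ} (ht : 0 < t) (x : E) :
    IntegrableOn (fun σ => (σ - t) ^ (-s) * heatD σ x) (Ioi t) := by
  obtain ⟨K, hK, h⟩ := exists_abs_heatD_le_rpow (E := E)
  set n : ℝ := (Module.finrank ℝ E : ℝ) with hn
  have hm : Measurable fun σ => (σ - t) ^ (-s) * heatD σ x := by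
    have := measurable_heatD_left x
    fun_prop
  rw [← Ioc_union_Ioi_eq_Ioi (show t ≤ t + 1 by linarith), integrableOn_union]
  constructor
  · have h1 : IntegrableOn (fun σ : ℝ => (σ - t) ^ (-s)) (Ioc t (t + 1)) := by
      have := (intervalIntegral.intervalIntegrable_rpow' (a := 0) (b := 1) (r := -s)
        (by linarith)).comp_sub_right t
      rw [zero_add, add_comm 1 t] at this
      exact (intervalIntegrable_iff_integrableOn_Ioc_of_le (by linarith)).1 this
    refine (h1.mul_const (K * t ^ (-1 - n / 2))).mono' hm.aestronglyMeasurable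
      ((ae_restrict_iff' measurableSet_Ioc).2 (ae_of_all _ fun σ hσ => ?_))
    have h0 : 0 < σ - t := sub_pos.2 hσ.1
    rw [norm_mul, Real.norm_of_nonneg (by positivity)]
    gcongr
    refine (h σ (ht.trans hσ.1) x).trans ?_
    gcongr ?_ * ?_
    exact Real.rpow_le_rpow_of_nonpos ht hσ.1.le (by linarith [show 0 ≤ n by rw [hn]; positivity])
  · have h1 := (integrableOn_heatD (show 0 < t + 1 by linarith) x).norm
    refine h1.mono' hm.aestronglyMeasurable
      ((ae_restrict_iff' measurableSet_Ioi).2 (ae_of_all _ fun σ hσ => ?_))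
    have h0 : 1 < σ - t := by have : t + 1 < σ := hσ; linarith
    rw [norm_mul, Real.norm_of_nonneg (by positivity)]
    exact mul_le_of_le_one_left (norm_nonneg _) (Real.rpow_le_one_of_one_le_of_nonpos h0.le (by linarith))

omit [MeasurableSpace E] [BorelSpace E] in
theorem integral_rpow_mul_heat_sub_heat (hs0 : 0 < s) (hs1 : s < 1) {t : ℝ} (ht : 0 < t) (x : E) :
    ∫ r in Ioi (0 : ℝ), r ^ (-s - 1) * (heat t x - heat (t + r) x)
      = s⁻¹ * ∫ σ in Ioi t, (σ - t) ^ (-s) * heatD σ x := by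
  have hintg := integrableOn_rpow_mul_heatD hs0 hs1 ht x
  have hDm := measurable_heatD_left x
  let F : ℝ → ℝ → ℝ := fun σ r => (Ici (σ - t)).indicator (fun r => r ^ (-s - 1)) r * heatD σ x
  have hS : MeasurableSet {q : ℝ × ℝ | q.1 - t ≤ q.2} := measurableSet_le (by fun_prop) (by fun_prop)
  have hFm : Measurable (Function.uncurry F) := by
    have : Function.uncurry F = fun q => {q : ℝ × ℝ | q.1 - t ≤ q.2}.indicator
        (fun q => q.2 ^ (-s - 1)) q * heatD q.1 x := by
      ext ⟨σ, r⟩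
      simp [F, indicator_apply]
    rw [this]
    exact (Measurable.indicator (by fun_prop) hS).mul (hDm.comp measurable_fst)
  have hker : ∀ σ ∈ Ioi t, IntegrableOn ((Ici (σ - t)).indicator (fun r : ℝ => r ^ (-s - 1))) (Ioi 0) ∧
      ∫ r in Ioi (0 : ℝ), (Ici (σ - t)).indicator (fun r : ℝ => r ^ (-s - 1)) r
        = s⁻¹ * (σ - t) ^ (-s) := by
    intro σ hσ
    have h0 : 0 < σ - t := sub_pos.2 hσ
    have hintg := integrableOn_Ioi_rpow_of_lt (a := -s - 1) (by linarith) h0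
    constructor
    · exact ((integrable_indicator_iff measurableSet_Ici).2
        ((integrableOn_Ici_iff_integrableOn_Ioi).2 hintg)).integrableOn
    · rw [setIntegral_indicator measurableSet_Ici,
        inter_eq_right.2 (show Ici (σ - t) ⊆ Ioi 0 from fun r hr => h0.trans_le hr),
        integral_Ici_eq_integral_Ioi, integral_Ioi_rpow_of_lt (by linarith) h0,
        show -s - 1 + 1 = -s by ring, neg_div_neg_eq]
      ring
  have hF : Integrable (Function.uncurry F) ((volume.restrict (Ioi t)).prod (volume.restrict (Ioi 0))) := by
    rw [integrable_prod_iff hFm.aestronglyMeasurable]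
    constructor
    · refine (ae_restrict_iff' measurableSet_Ioi).2 (ae_of_all _ fun σ hσ => ?_)
      exact Integrable.mul_const (hker σ hσ).1 (heatD σ x)
    · refine (hintg.norm.const_mul s⁻¹).congr
        ((ae_restrict_iff' measurableSet_Ioi).2 (ae_of_all _ fun σ hσ => ?_))
      have h0 : 0 < σ - t := sub_pos.2 hσ
      have : ∀ r ∈ Ioi (0 : ℝ), ‖Function.uncurry F (σ, r)‖
          = (Ici (σ - t)).indicator (fun r : ℝ => r ^ (-s - 1)) r * |heatD σ x| := by
        intro r hr
        have hr : 0 < r := hr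
        simp only [Function.uncurry, F, norm_mul, Real.norm_eq_abs]
        rw [abs_of_nonneg (indicator_apply_nonneg fun _ => by positivity)]
      beta_reduce
      rw [setIntegral_congr_fun measurableSet_Ioi this, integral_mul_const, (hker σ hσ).2, norm_mul,
        Real.norm_of_nonneg (by positivity), Real.norm_eq_abs]
      ring
  have hswap := integral_integral_swap hF
  have hl : ∀ σ ∈ Ioi t, ∫ r in Ioi (0 : ℝ), F σ r = s⁻¹ * ((σ - t) ^ (-s) * heatD σ x) := by
    intro σ hσ
    simp only [F]
    rw [integral_mul_const, (hker σ hσ).2, mul_assoc]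
  have hr : ∀ r ∈ Ioi (0 : ℝ), ∫ σ in Ioi t, F σ r = r ^ (-s - 1) * (heat t x - heat (t + r) x) := by
    intro r hr
    have hr : 0 < r := hr
    have e : ∀ σ, F σ r = (Iic (t + r)).indicator (fun σ => r ^ (-s - 1) * heatD σ x) σ := by
      intro σ
      simp only [F, indicator_apply, mem_Ici, mem_Iic, sub_le_iff_le_add, add_comm r t]
      split_ifs <;> simp
    simp_rw [e]
    rw [setIntegral_indicator measurableSet_Iic, Ioi_inter_Iic, integral_const_mul,
      integral_heatD_Ioc ht hr.le]
  rw [← setIntegral_congr_fun measurableSet_Ioi hr, ← hswap, setIntegral_congr_fun measurableSet_Ioi hl,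
    integral_const_mul]

theorem exists_fracLap_heat_eq_integral_heatD (hs0 : 0 < s) (hs1 : s < 1) :
    ∃ C, 0 < C ∧ ∀ t, 0 < t → ∀ x₀ x : E, fracLap s (fun y => heat t (x₀ - y)) x
      = C * ∫ σ in Ioi t, (σ - t) ^ (-s) * heatD σ (x₀ - x) := by
  obtain ⟨C, hC, h⟩ := exists_fracLap_heat_eq (E := E) hs0 hs1
  refine ⟨C * s⁻¹, by positivity, fun t ht x₀ x => ?_⟩
  rw [h t ht, integral_rpow_mul_heat_sub_heat hs0 hs1 ht, mul_assoc]

end FracLapHeat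

section Abel

variable {s : ℝ}

theorem integral_rpow_mul_one_sub_rpow (hs0 : 0 < s) (hs1 : s < 1) :
    ∫ x in (0 : ℝ)..1, x ^ (s - 1) * (1 - x) ^ (-s) = ProbabilityTheory.beta s (1 - s) := by
  rw [ProbabilityTheory.beta_eq_betaIntegralReal s (1 - s) hs0 (by linarith),
    Complex.betaIntegral, intervalIntegral.integral_of_le zero_le_one,
    intervalIntegral.integral_of_le zero_le_one, ← RCLike.re_to_complex, ← integral_re]
  · refine setIntegral_congr_fun measurableSet_Ioc fun x ⟨hx1, hx₂⟩ ↦ ?_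
    norm_cast
    rw [← Complex.ofReal_cpow, ← Complex.ofReal_cpow, RCLike.re_to_complex,
      Complex.re_mul_ofReal, Complex.ofReal_re]
    · ring_nf
    all_goals linarith
  · have := Complex.betaIntegral_convergent (u := s) (v := (1 - s : ℝ)) (by simpa) (by simpa)
    rwa [intervalIntegrable_iff_integrableOn_Ioc_of_le zero_le_one, IntegrableOn] at this

theorem integral_abel_kernel (hs0 : 0 < s) (hs1 : s < 1) {σ : ℝ} (hσ : 1 < σ) :
    ∫ t in Ioo 1 σ, (t - 1) ^ (s - 1) * (σ - t) ^ (-s) = ProbabilityTheory.beta s (1 - s) := by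
  have h0 : 0 < σ - 1 := by linarith
  rw [← integral_rpow_mul_one_sub_rpow hs0 hs1, ← integral_Ioc_eq_integral_Ioo,
    ← intervalIntegral.integral_of_le hσ.le]
  have h := intervalIntegral.smul_integral_comp_mul_add (a := 0) (b := 1)
    (fun t : ℝ => (t - 1) ^ (s - 1) * (σ - t) ^ (-s)) (σ - 1) 1
  simp only [mul_zero, zero_add, mul_one, sub_add_cancel] at h
  rw [← h, ← intervalIntegral.integral_smul]
  apply intervalIntegral.integral_congr_ae
  refine ae_of_all _ fun x hx => ?_
  rw [uIoc_of_le zero_le_one] at hx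
  have hx0 := hx.1
  have hx1 : 0 ≤ 1 - x := by linarith [hx.2]
  rw [show (σ - 1) * x + 1 - 1 = (σ - 1) * x by ring, show σ - ((σ - 1) * x + 1) = (σ - 1) * (1 - x) by ring,
    Real.mul_rpow h0.le hx0.le, Real.mul_rpow h0.le hx1, smul_eq_mul]
  have : (σ - 1) * ((σ - 1) ^ (s - 1) * (σ - 1) ^ (-s)) = 1 := by
    rw [← Real.rpow_add h0, show s - 1 + -s = -1 by ring, Real.rpow_neg_one, mul_inv_cancel₀ h0.ne']
  linear_combination (x ^ (s - 1) * (1 - x) ^ (-s)) * this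

/-- The kernel of the Abel integral equation on `(1, ∞)`. -/
noncomputable def abelKernel (s t σ : ℝ) : ℝ :=
  {q : ℝ × ℝ | q.1 < q.2}.indicator (fun q => (q.1 - 1) ^ (s - 1) * (q.2 - q.1) ^ (-s)) (t, σ)

theorem measurable_abelKernel : Measurable fun q : ℝ × ℝ => abelKernel s q.1 q.2 :=
  Measurable.indicator (by fun_prop) (measurableSet_lt (by fun_prop) (by fun_prop))

theorem abelKernel_nonneg {t : ℝ} (ht : 1 < t) (σ : ℝ) : 0 ≤ abelKernel s t σ := by
  have : 0 ≤ t - 1 := by linarith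
  refine indicator_apply_nonneg fun h => ?_
  have : 0 ≤ σ - t := sub_nonneg.2 (le_of_lt h)
  simp only
  positivity

theorem abelKernel_eq_indicator_left (σ t : ℝ) :
    abelKernel s t σ = (Iio σ).indicator (fun t => (t - 1) ^ (s - 1) * (σ - t) ^ (-s)) t := by
  simp [abelKernel, indicator_apply]

theorem abelKernel_eq_indicator_right (σ t : ℝ) :
    abelKernel s t σ = (Ioi t).indicator (fun σ => (t - 1) ^ (s - 1) * (σ - t) ^ (-s)) σ := by
  simp [abelKernel, indicator_apply]

theorem integral_abelKernel (hs0 : 0 < s) (hs1 : s < 1) {σ : ℝ} (hσ : 1 < σ) :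
    ∫ t in Ioi 1, abelKernel s t σ = ProbabilityTheory.beta s (1 - s) := by
  simp_rw [abelKernel_eq_indicator_left]
  rw [setIntegral_indicator measurableSet_Iio, Ioi_inter_Iio, integral_abel_kernel hs0 hs1 hσ]

theorem lintegral_enorm_abelKernel (hs0 : 0 < s) (hs1 : s < 1) {σ : ℝ} (hσ : 1 < σ) :
    ∫⁻ t in Ioi 1, ‖abelKernel s t σ‖ₑ = ENNReal.ofReal (ProbabilityTheory.beta s (1 - s)) := by
  have hB := ProbabilityTheory.beta_pos hs0 (sub_pos.2 hs1)
  have h := integral_abelKernel hs0 hs1 hσ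
  rw [← h, ofReal_integral_eq_lintegral_ofReal (Integrable.of_integral_ne_zero (by rw [h]; exact hB.ne'))
    ((ae_restrict_iff' measurableSet_Ioi).2 (ae_of_all _ fun t ht => abelKernel_nonneg ht σ))]
  refine setLIntegral_congr_fun measurableSet_Ioi fun t ht => ?_
  exact Real.enorm_of_nonneg (abelKernel_nonneg ht σ)

theorem lintegral_lintegral_enorm_abelKernel_mul (hs0 : 0 < s) (hs1 : s < 1) {h : ℝ → ℝ}
    (hm : Measurable h) :
    ∫⁻ t in Ioi (1 : ℝ), ∫⁻ σ in Ioi (1 : ℝ), ‖abelKernel s t σ * h σ‖ₑ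
      = ENNReal.ofReal (ProbabilityTheory.beta s (1 - s)) * ∫⁻ σ in Ioi (1 : ℝ), ‖h σ‖ₑ := by
  have hk := measurable_abelKernel (s := s)
  rw [lintegral_lintegral_swap, ← lintegral_const_mul _ (by fun_prop)]
  · refine setLIntegral_congr_fun measurableSet_Ioi fun σ hσ => ?_
    simp_rw [enorm_mul]
    have hk' : Measurable fun t => abelKernel s t σ := hk.comp (measurable_id.prodMk measurable_const)
    rw [lintegral_mul_const _ (by fun_prop), lintegral_enorm_abelKernel hs0 hs1 hσ]
  · exact (hk.mul (hm.comp measurable_snd)).enorm.aemeasurable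

theorem integral_integral_abelKernel_mul (hs0 : 0 < s) (hs1 : s < 1) {h : ℝ → ℝ}
    (hm : Measurable h) (hintg : IntegrableOn h (Ioi 1)) :
    IntegrableOn (fun t => ∫ σ in Ioi (1 : ℝ), abelKernel s t σ * h σ) (Ioi 1) ∧
    ∫ t in Ioi (1 : ℝ), ∫ σ in Ioi (1 : ℝ), abelKernel s t σ * h σ
      = ProbabilityTheory.beta s (1 - s) * ∫ σ in Ioi (1 : ℝ), h σ := by
  have hk := measurable_abelKernel (s := s)
  have hI : Integrable (Function.uncurry fun t σ => abelKernel s t σ * h σ)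
      ((volume.restrict (Ioi 1)).prod (volume.restrict (Ioi 1))) := by
    have hm2 : Measurable (Function.uncurry fun t σ => abelKernel s t σ * h σ) :=
      hk.mul (hm.comp measurable_snd)
    refine ⟨hm2.aestronglyMeasurable, ?_⟩
    rw [HasFiniteIntegral, lintegral_prod _ hm2.enorm.aemeasurable]
    refine (lintegral_lintegral_enorm_abelKernel_mul hs0 hs1 hm).trans_lt ?_
    exact ENNReal.mul_lt_top ENNReal.ofReal_lt_top hintg.2
  refine ⟨hI.integral_prod_left, ?_⟩
  rw [integral_integral_swap hI, ← integral_const_mul]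
  refine setIntegral_congr_fun measurableSet_Ioi fun σ hσ => ?_
  rw [integral_mul_const, integral_abelKernel hs0 hs1 hσ]

end Abel

section HeatIdentity

variable {E : Type*} [NormedAddCommGroup E] [InnerProductSpace ℝ E] [FiniteDimensional ℝ E]
  [MeasurableSpace E] [BorelSpace E] [Nontrivial E] {s α p : ℝ} {u : E → ℝ}

theorem integrable_mul_schwartzMap {f : E → ℝ} (hf : AEStronglyMeasurable f)
    (hfin : ∫⁻ x, ‖f x‖ₑ * ENNReal.ofReal ((max 1 ‖x‖) ^ (-(Module.finrank ℝ E : ℝ))) < ⊤)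
    (φ : SchwartzMap E ℝ) : Integrable fun x => f x * φ x := by
  obtain ⟨C, hC, h⟩ := exists_abs_schwartzMap_le φ (Module.finrank ℝ E)
  refine ⟨hf.mul φ.continuous.aestronglyMeasurable, ?_⟩
  calc ∫⁻ x, ‖f x * φ x‖ₑ
      ≤ ∫⁻ x, ENNReal.ofReal C * (‖f x‖ₑ * ENNReal.ofReal ((max 1 ‖x‖) ^ (-(Module.finrank ℝ E : ℝ)))) := by
        apply lintegral_mono
        intro x
        simp only
        rw [enorm_mul, mul_left_comm, ← ENNReal.ofReal_mul hC.le]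
        gcongr
        rw [Real.enorm_eq_ofReal_abs]
        exact ENNReal.ofReal_le_ofReal (h x)
    _ = ENNReal.ofReal C * _ := lintegral_const_mul' _ _ ENNReal.ofReal_ne_top
    _ < ⊤ := ENNReal.mul_lt_top ENNReal.ofReal_lt_top hfin

theorem IsSolution.integral_mul_heat (hu : IsSolution s α p u) (hs0 : 0 < s) (hs1 : s < 1)
    (hU : ∫⁻ x, ENNReal.ofReal (u x) * ENNReal.ofReal ((max 1 ‖x‖) ^ (-(Module.finrank ℝ E : ℝ))) < ⊤)
    (hF : ∫⁻ x, ENNReal.ofReal (‖x‖ ^ α * u x ^ p) *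
      ENNReal.ofReal ((max 1 ‖x‖) ^ (-(Module.finrank ℝ E : ℝ))) < ⊤) :
    ∃ c, 0 < c ∧ ∀ x₀, ∫⁻ x, ENNReal.ofReal (u x * heat 1 (x₀ - x))
      = ENNReal.ofReal c * ∫⁻ t in Ioi (1 : ℝ), ∫⁻ y,
        ENNReal.ofReal ((t - 1) ^ (s - 1) * (‖y‖ ^ α * u y ^ p * heat t (x₀ - y))) := by
  obtain ⟨C, hC, hlap⟩ := exists_fracLap_heat_eq_integral_heatD (E := E) hs0 hs1
  obtain ⟨C', hC', hD⟩ := exists_lintegral_abs_heatD_le (E := E)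
  have hB := ProbabilityTheory.beta_pos hs0 (sub_pos.2 hs1)
  set B := ProbabilityTheory.beta s (1 - s)
  set n : ℝ := (Module.finrank ℝ E : ℝ) with hn
  have hk := measurable_abelKernel (s := s)
  have hum := hu.measurable
  refine ⟨(B * C)⁻¹, by positivity, fun x₀ => ?_⟩
  have hDm : Measurable fun q : E × ℝ => heatD q.2 (x₀ - q.1) := by
    unfold heatD heat; fun_prop
  have hDx : ∀ y : E, Measurable fun σ => heatD σ y := measurable_heatD_left
  have hUx : ∫⁻ x, ‖u x‖ₑ * ∫⁻ σ in Ioi (1 : ℝ), ‖heatD σ (x₀ - x)‖ₑ < ⊤ := by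
    calc _ ≤ ∫⁻ x, ENNReal.ofReal (C' * (1 + ‖x₀‖) ^ n) *
          (ENNReal.ofReal (u x) * ENNReal.ofReal ((max 1 ‖x‖) ^ (-n))) := by
          apply lintegral_mono_ae
          filter_upwards [hu.pos] with x hx
          rw [Real.enorm_of_nonneg hx.le, mul_left_comm, ← ENNReal.ofReal_mul (by positivity)]
          gcongr
          simp_rw [Real.enorm_eq_ofReal_abs]
          refine (hD (x₀ - x)).trans (ENNReal.ofReal_le_ofReal ?_)
          rw [mul_assoc]
          gcongr
          exact max_one_norm_sub_rpow_le (by positivity) x₀ x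
      _ = _ := lintegral_const_mul' _ _ ENNReal.ofReal_ne_top
      _ < ⊤ := ENNReal.mul_lt_top ENNReal.ofReal_lt_top hU
  let J : E → ℝ → ℝ := fun x t => ∫ σ in Ioi (1 : ℝ), abelKernel s t σ * heatD σ (x₀ - x)
  have hJm : StronglyMeasurable (Function.uncurry J) := by
    apply StronglyMeasurable.integral_prod_right
      (f := fun (q : E × ℝ) σ => abelKernel s q.2 σ * heatD σ (x₀ - q.1))
    apply Measurable.stronglyMeasurable
    exact (hk.comp ((measurable_snd.comp measurable_fst).prodMk measurable_snd)).mul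
      (hDm.comp ((measurable_fst.comp measurable_fst).prodMk measurable_snd))
  have hJ : ∀ x, IntegrableOn (J x) (Ioi 1) ∧ ∫ t in Ioi (1 : ℝ), J x t = B * heat 1 (x₀ - x) := by
    intro x
    have h := integral_integral_abelKernel_mul hs0 hs1 (hDx (x₀ - x)) (integrableOn_heatD one_pos _)
    rw [integral_heatD_Ioi one_pos] at h
    exact h
  have hΘ : Integrable (Function.uncurry fun x t => u x * J x t)
      ((volume : Measure E).prod (volume.restrict (Ioi 1))) := by
    have hm : AEStronglyMeasurable (Function.uncurry fun x t => u x * J x t)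
        ((volume : Measure E).prod (volume.restrict (Ioi 1))) :=
      ((hum.comp measurable_fst).stronglyMeasurable.mul hJm).aestronglyMeasurable
    refine ⟨hm, ?_⟩
    rw [HasFiniteIntegral, lintegral_prod _ hm.enorm]
    calc _ ≤ ∫⁻ x, ENNReal.ofReal B * (‖u x‖ₑ * ∫⁻ σ in Ioi (1 : ℝ), ‖heatD σ (x₀ - x)‖ₑ) := by
          apply lintegral_mono
          intro x
          simp only [Function.uncurry, enorm_mul]
          rw [lintegral_const_mul' _ _ enorm_ne_top, mul_left_comm,
            ← lintegral_lintegral_enorm_abelKernel_mul hs0 hs1 (hDx _)]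
          gcongr
          exact enorm_integral_le_lintegral_enorm _
      _ = _ := lintegral_const_mul' _ _ ENNReal.ofReal_ne_top
      _ < ⊤ := ENNReal.mul_lt_top ENNReal.ofReal_lt_top hUx
  have hleft : (fun x => ∫ t in Ioi (1 : ℝ), u x * J x t) = fun x => B * (u x * heat 1 (x₀ - x)) := by
    ext x
    rw [integral_const_mul, (hJ x).2]
    ring
  have hright : ∀ t ∈ Ioi (1 : ℝ), ∫ x, u x * J x t
      = C⁻¹ * ((t - 1) ^ (s - 1) * ∫ y, ‖y‖ ^ α * u y ^ p * heat t (x₀ - y)) := by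
    intro t ht
    have ht : 1 < t := ht
    have ht0 : 0 < t := by linarith
    obtain ⟨φ, hφ⟩ := exists_schwartzMap_heat ht0 x₀
    have hφ' : (fun y => heat t (x₀ - y)) = φ := by ext y; rw [hφ]
    have hw := hu.weak φ
    simp_rw [hφ] at hw
    rw [← hw, ← hφ', ← mul_assoc, ← integral_const_mul]
    congr 1
    ext x
    rw [hlap t ht0]
    have : J x t = (t - 1) ^ (s - 1) * ∫ σ in Ioi t, (σ - t) ^ (-s) * heatD σ (x₀ - x) := by
      simp only [J]
      have e : ∀ σ, abelKernel s t σ * heatD σ (x₀ - x) = (Ioi t).indicator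
          (fun σ => (t - 1) ^ (s - 1) * ((σ - t) ^ (-s) * heatD σ (x₀ - x))) σ := by
        intro σ
        rw [abelKernel_eq_indicator_right]
        simp only [indicator_apply]
        split_ifs
        · ring
        · simp
      simp_rw [e]
      rw [setIntegral_indicator measurableSet_Ioi,
        inter_eq_right.2 (Ioi_subset_Ioi ht.le : Ioi t ⊆ Ioi 1), integral_const_mul]
    rw [this]
    field_simp
  have hfm : Measurable fun y => ‖y‖ ^ α * u y ^ p := by fun_prop
  have hfnn : ∀ᵐ y, 0 ≤ ‖y‖ ^ α * u y ^ p := by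
    filter_upwards [hu.pos] with y hy
    positivity
  have hF' : ∫⁻ x, ‖‖x‖ ^ α * u x ^ p‖ₑ * ENNReal.ofReal ((max 1 ‖x‖) ^ (-n)) < ⊤ := by
    refine lt_of_eq_of_lt (lintegral_congr_ae ?_) hF
    filter_upwards [hfnn] with y hy
    rw [Real.enorm_of_nonneg hy]
  have hfint : ∀ t, 0 < t → Integrable fun y => ‖y‖ ^ α * u y ^ p * heat t (x₀ - y) := by
    intro t ht
    obtain ⟨φ, hφ⟩ := exists_schwartzMap_heat ht x₀
    simpa only [hφ] using integrable_mul_schwartzMap hfm.aestronglyMeasurable hF' φ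
  have hswap := integral_integral_swap hΘ
  have hu_int : Integrable fun x => u x * heat 1 (x₀ - x) := by
    have := hΘ.integral_prod_left
    simp only [Function.uncurry] at this
    rw [hleft] at this
    refine (this.const_mul B⁻¹).congr (ae_of_all _ fun x => ?_)
    simp only
    field_simp
  have hg_int : IntegrableOn (fun t => (t - 1) ^ (s - 1) * ∫ y, ‖y‖ ^ α * u y ^ p * heat t (x₀ - y)) (Ioi 1) := by
    have := hΘ.integral_prod_right
    refine (this.const_mul C).congr ((ae_restrict_iff' measurableSet_Ioi).2 (ae_of_all _ fun t ht => ?_))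
    simp only [Function.uncurry]
    rw [hright t ht]
    field_simp
  rw [hleft, integral_const_mul, setIntegral_congr_fun measurableSet_Ioi hright,
    integral_const_mul] at hswap
  have hmain : ∫ x, u x * heat 1 (x₀ - x) = (B * C)⁻¹ *
      ∫ t in Ioi (1 : ℝ), (t - 1) ^ (s - 1) * ∫ y, ‖y‖ ^ α * u y ^ p * heat t (x₀ - y) := by
    rw [mul_inv, mul_assoc, ← hswap]
    field_simp
  rw [← ofReal_integral_eq_lintegral_ofReal hu_int, hmain, ENNReal.ofReal_mul (by positivity),
    ofReal_integral_eq_lintegral_ofReal hg_int]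
  · congr 1
    refine setLIntegral_congr_fun measurableSet_Ioi fun t ht => ?_
    have ht : 1 < t := ht
    rw [← integral_const_mul, ofReal_integral_eq_lintegral_ofReal ((hfint t (by linarith)).const_mul _)]
    filter_upwards [hfnn] with y hy
    have := heat_pos (show 0 < t by linarith) (x₀ - y)
    have h1 : 0 ≤ t - 1 := by linarith
    simp only [Pi.zero_apply]
    exact mul_nonneg (by positivity) (mul_nonneg hy this.le)
  · refine (ae_restrict_iff' measurableSet_Ioi).2 (ae_of_all _ fun t ht => ?_)
    have ht : 1 < t := ht
    have h1 : 0 ≤ t - 1 := by linarith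
    refine mul_nonneg (by positivity) (integral_nonneg_of_ae ?_)
    filter_upwards [hfnn] with y hy
    exact mul_nonneg hy (heat_pos (show 0 < t by linarith) (x₀ - y)).le
  · filter_upwards [hu.pos] with x hx
    exact mul_nonneg hx.le (heat_pos one_pos _).le

end HeatIdentity

section Uniqueness

variable {E : Type*} [NormedAddCommGroup E] [InnerProductSpace ℝ E] [FiniteDimensional ℝ E]
  [MeasurableSpace E] [BorelSpace E]

theorem ext_of_lintegral_exp_inner {μ ν : Measure E} [IsFiniteMeasure μ] [IsFiniteMeasure ν]
    (hfin : ∀ ξ : E, ∫⁻ x, ENNReal.ofReal (Real.exp (inner ℝ x ξ)) ∂μ < ⊤)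
    (h : ∀ ξ : E, ∫⁻ x, ENNReal.ofReal (Real.exp (inner ℝ x ξ)) ∂μ =
      ∫⁻ x, ENNReal.ofReal (Real.exp (inner ℝ x ξ)) ∂ν) : μ = ν := by
  have hintg : ∀ (ρ : Measure E) (ξ : E), ∫⁻ x, ENNReal.ofReal (Real.exp (inner ℝ x ξ)) ∂ρ < ⊤ →
      Integrable (fun x => Real.exp (inner ℝ x ξ)) ρ := by
    intro ρ ξ hρ
    refine ⟨by fun_prop, ?_⟩
    rw [hasFiniteIntegral_iff_ofReal (ae_of_all _ fun x => (Real.exp_pos _).le)]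
    exact hρ
  have hzero : μ = 0 ↔ ν = 0 := by
    have h0 := h 0
    simp only [inner_zero_right, Real.exp_zero, ENNReal.ofReal_one, lintegral_const, one_mul] at h0
    rw [← Measure.measure_univ_eq_zero, h0, Measure.measure_univ_eq_zero]
  refine Measure.ext_of_charFun (funext fun ξ => ?_)
  have hset : ProbabilityTheory.integrableExpSet (fun x => inner ℝ x ξ) μ = univ := by
    refine eq_univ_of_forall fun t => ?_
    have := hintg μ (t • ξ) (hfin _)
    simpa [ProbabilityTheory.integrableExpSet, inner_smul_right] using this
  have hmgf : ProbabilityTheory.mgf (fun x => inner ℝ x ξ) μ =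
      ProbabilityTheory.mgf (fun x => inner ℝ x ξ) ν := by
    funext t
    have e : ∀ x : E, t * inner ℝ x ξ = inner ℝ x (t • ξ) := fun x => by
      rw [inner_smul_right]
    simp only [ProbabilityTheory.mgf, e]
    rw [integral_eq_lintegral_of_nonneg_ae (ae_of_all _ fun x => (Real.exp_pos _).le)
        (by fun_prop), h,
      ← integral_eq_lintegral_of_nonneg_ae (ae_of_all _ fun x => (Real.exp_pos _).le)
        (by fun_prop)]
  have key := ProbabilityTheory.eqOn_complexMGF_of_mgf' hmgf hzero (x := Complex.I)
    (by simp [hset])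
  simp only [ProbabilityTheory.complexMGF] at key
  simp only [charFun_apply]
  convert key using 3 <;> · rw [mul_comm]

theorem heat_one_sub (x₀ x : E) :
    heat 1 (x₀ - x) = heat 1 x * Real.exp (-(‖x₀‖ ^ 2 / 4)) *
      Real.exp (inner ℝ x ((1 / 2 : ℝ) • x₀)) := by
  simp only [heat]
  rw [mul_assoc, mul_assoc _ _ (Real.exp (inner ℝ _ _)), ← Real.exp_add, mul_assoc, ← Real.exp_add,
    norm_sub_sq_real, inner_smul_right, real_inner_comm]
  congr 2
  ring

theorem ae_eq_of_lintegral_heat_mul {f g : E → ENNReal} (hf : Measurable f) (hg : Measurable g)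
    (hfin : ∀ x₀ : E, ∫⁻ x, ENNReal.ofReal (heat 1 (x₀ - x)) * f x < ⊤)
    (h : ∀ x₀ : E, ∫⁻ x, ENNReal.ofReal (heat 1 (x₀ - x)) * f x =
      ∫⁻ x, ENNReal.ofReal (heat 1 (x₀ - x)) * g x) : f =ᵐ[volume] g := by
  have hheat : Measurable fun x : E => ENNReal.ofReal (heat 1 x) :=
    (continuous_heat 1).measurable.ennreal_ofReal
  have e : ∀ {k : E → ENNReal}, Measurable k → ∀ ξ : E,
      ∫⁻ x, ENNReal.ofReal (Real.exp (inner ℝ x ξ))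
        ∂(volume.withDensity fun x => ENNReal.ofReal (heat 1 x) * k x) =
      ENNReal.ofReal (Real.exp (‖(2 : ℝ) • ξ‖ ^ 2 / 4)) *
        ∫⁻ x, ENNReal.ofReal (heat 1 ((2 : ℝ) • ξ - x)) * k x := by
    intro k hk ξ
    rw [lintegral_withDensity_eq_lintegral_mul _ (show Measurable fun x =>
        ENNReal.ofReal (heat 1 x) * k x from hheat.mul hk) (show Measurable fun x : E =>
        ENNReal.ofReal (Real.exp (inner ℝ x ξ)) by fun_prop),
      ← lintegral_const_mul' _ _ ENNReal.ofReal_ne_top]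
    refine lintegral_congr fun x => ?_
    simp only [Pi.mul_apply]
    rw [heat_one_sub, smul_smul, ← mul_assoc, ← ENNReal.ofReal_mul (Real.exp_pos _).le, mul_right_comm,
      ← ENNReal.ofReal_mul (heat_pos one_pos x).le]
    congr 2
    have : Real.exp (‖(2 : ℝ) • ξ‖ ^ 2 / 4) * Real.exp (-(‖(2 : ℝ) • ξ‖ ^ 2 / 4)) = 1 := by
      rw [← Real.exp_add]; simp
    norm_num only [one_smul]
    linear_combination (-heat 1 x * Real.exp (inner ℝ x ξ)) * this
  have hfinite : ∀ {k : E → ENNReal}, ∫⁻ x, ENNReal.ofReal (heat 1 (0 - x)) * k x < ⊤ →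
      IsFiniteMeasure (volume.withDensity fun x => ENNReal.ofReal (heat 1 x) * k x) := by
    intro k hk
    refine isFiniteMeasure_withDensity (ne_of_lt ?_)
    simpa [heat_neg] using hk
  have := hfinite (hfin 0)
  have := hfinite (h 0 ▸ hfin 0)
  have hμ : (volume.withDensity fun x => ENNReal.ofReal (heat 1 x) * f x) =
      volume.withDensity fun x => ENNReal.ofReal (heat 1 x) * g x := by
    refine ext_of_lintegral_exp_inner (fun ξ => ?_) fun ξ => ?_
    · rw [e hf]
      exact ENNReal.mul_lt_top ENNReal.ofReal_lt_top (hfin _)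
    · rw [e hf, e hg, h]
  have hae := (withDensity_eq_iff_of_sigmaFinite (hheat.mul hf).aemeasurable
    (hheat.mul hg).aemeasurable).1 hμ
  filter_upwards [hae] with x hx
  exact (ENNReal.mul_right_inj (by simpa using heat_pos one_pos x) ENNReal.ofReal_ne_top).1 hx

end Uniqueness

section RieszPotential

variable {E : Type*} [NormedAddCommGroup E] [InnerProductSpace ℝ E] [FiniteDimensional ℝ E]
  [MeasurableSpace E] [BorelSpace E]

theorem lintegral_heat_one_mul_heat {r : ℝ} (hr : 0 < r) (x₀ y : E) :
    ∫⁻ x, ENNReal.ofReal (heat 1 (x₀ - x)) * ENNReal.ofReal (heat r (x - y)) =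
      ENNReal.ofReal (heat (1 + r) (x₀ - y)) := by
  rw [← lintegral_heat_mul_heat one_pos hr,
    ← lintegral_sub_right_eq_self (fun x => ENNReal.ofReal (heat 1 (x₀ - y - x) * heat r x)) y]
  refine lintegral_congr fun x => ?_
  rw [← ENNReal.ofReal_mul (heat_pos one_pos _).le, sub_sub_sub_cancel_right]

theorem setLIntegral_Ioi_shift (g : ℝ → ENNReal) (a : ℝ) :
    ∫⁻ t in Ioi a, g t = ∫⁻ r in Ioi 0, g (a + r) := by
  rw [← lintegral_indicator measurableSet_Ioi, ← lintegral_indicator measurableSet_Ioi,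
    ← lintegral_add_left_eq_self _ a]
  refine lintegral_congr fun r => ?_
  by_cases hr : 0 < r
  · rw [indicator_of_mem (by simpa using hr), indicator_of_mem (by simpa using hr)]
  · rw [indicator_of_notMem (by simpa using hr), indicator_of_notMem (by simpa using hr)]

theorem lintegral_lintegral_heat_eq [Nontrivial E] {s C : ℝ} {f : E → ℝ} (hf : Measurable f)
    (hC0 : 0 < C)
    (hC : ∀ x : E, x ≠ 0 → ∫⁻ σ in Ioi (0 : ℝ), ENNReal.ofReal (σ ^ (s - 1) * heat σ x) =
      ENNReal.ofReal (C * ‖x‖ ^ (2 * s - Module.finrank ℝ E))) (x₀ : E) :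
    ∫⁻ t in Ioi (1 : ℝ), ∫⁻ y, ENNReal.ofReal ((t - 1) ^ (s - 1) * (f y * heat t (x₀ - y))) =
      ∫⁻ x, ENNReal.ofReal (heat 1 (x₀ - x)) *
        ∫⁻ y, ENNReal.ofReal (‖x - y‖ ^ (2 * s - Module.finrank ℝ E) * (C * f y)) := by
  let G : ℝ → E → E → ENNReal := fun r x y =>
    ENNReal.ofReal (heat 1 (x₀ - x)) * (ENNReal.ofReal (f y) *
      (ENNReal.ofReal (r ^ (s - 1)) * ENNReal.ofReal (heat r (x - y))))
  have hG : Measurable fun w : ℝ × E × E => G w.1 w.2.1 w.2.2 := by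
    have h1 : Measurable fun w : ℝ × E × E => heat 1 (x₀ - w.2.1) :=
      (continuous_heat 1).measurable.comp (by fun_prop)
    have h2 : Measurable fun w : ℝ × E × E => heat w.1 (w.2.1 - w.2.2) :=
      measurable_heat_uncurry.comp
        (g := fun q : ℝ × E => heat q.1 q.2) (f := fun w : ℝ × E × E => (w.1, w.2.1 - w.2.2))
        (by fun_prop)
    exact h1.ennreal_ofReal.mul ((hf.comp (by fun_prop)).ennreal_ofReal.mul
      (Measurable.mul (by fun_prop) h2.ennreal_ofReal))
  have h1 : ∀ r ∈ Ioi (0 : ℝ),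
      ∫⁻ y, ENNReal.ofReal ((1 + r - 1) ^ (s - 1) * (f y * heat (1 + r) (x₀ - y))) =
        ∫⁻ x, ∫⁻ y, G r x y := by
    intro r hr
    have hr : 0 < r := hr
    rw [lintegral_lintegral_swap]
    · refine lintegral_congr fun y => ?_
      have e : ∀ x, G r x y = (ENNReal.ofReal (r ^ (s - 1)) * ENNReal.ofReal (f y)) *
          (ENNReal.ofReal (heat 1 (x₀ - x)) * ENNReal.ofReal (heat r (x - y))) := fun x => by
        simp only [G]; ring
      simp_rw [e]
      rw [lintegral_const_mul' _ _ (ENNReal.mul_ne_top ENNReal.ofReal_ne_top ENNReal.ofReal_ne_top),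
        lintegral_heat_one_mul_heat hr, mul_assoc,
        ← ENNReal.ofReal_mul' (heat_pos (by positivity) _).le, add_sub_cancel_left,
        ← ENNReal.ofReal_mul (by positivity)]
    · exact (hG.comp (f := fun w : E × E => (r, w.1, w.2)) (by fun_prop)).aemeasurable
  rw [setLIntegral_Ioi_shift, setLIntegral_congr_fun measurableSet_Ioi h1,
    lintegral_lintegral_swap]
  · refine lintegral_congr fun x => ?_
    rw [lintegral_lintegral_swap, ← lintegral_const_mul' _ _ ENNReal.ofReal_ne_top]
    · refine lintegral_congr_ae ?_
      filter_upwards [compl_mem_ae_iff.2 (measure_singleton x)] with y hy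
      have hxy : x - y ≠ 0 := sub_ne_zero.2 fun h => hy h.symm
      simp only [G]
      rw [lintegral_const_mul' _ _ ENNReal.ofReal_ne_top,
        lintegral_const_mul' _ _ ENNReal.ofReal_ne_top]
      congr 1
      have e : ∫⁻ r in Ioi (0 : ℝ), ENNReal.ofReal (r ^ (s - 1)) * ENNReal.ofReal (heat r (x - y)) =
          ENNReal.ofReal (C * ‖x - y‖ ^ (2 * s - Module.finrank ℝ E)) := by
        rw [← hC _ hxy]
        refine setLIntegral_congr_fun measurableSet_Ioi fun r hr => ?_
        have hr : 0 < r := hr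
        rw [ENNReal.ofReal_mul (by positivity)]
      rw [e, ← ENNReal.ofReal_mul' (by positivity)]
      congr 1
      ring
    · exact (hG.comp (f := fun w : ℝ × E => (w.1, x, w.2)) (by fun_prop)).aemeasurable
  · refine Measurable.aemeasurable ?_
    exact Measurable.lintegral_prod_right'
      (hG.comp (f := fun w : (ℝ × E) × E => (w.1.1, w.1.2, w.2)) (by fun_prop))

variable {s α p : ℝ} {u : E → ℝ}

theorem IsSolution.exists_ae_eq_rieszPotential [Nontrivial E] (hu : IsSolution s α p u)
    (hs0 : 0 < s) (hs1 : s < 1) (hns : 2 * s < (Module.finrank ℝ E : ℝ))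
    (hU : ∫⁻ x, ENNReal.ofReal (u x) *
      ENNReal.ofReal ((max 1 ‖x‖) ^ (-(Module.finrank ℝ E : ℝ))) < ⊤)
    (hF : ∫⁻ x, ENNReal.ofReal (‖x‖ ^ α * u x ^ p) *
      ENNReal.ofReal ((max 1 ‖x‖) ^ (-(Module.finrank ℝ E : ℝ))) < ⊤) :
    ∃ c, 0 < c ∧ (fun x => ENNReal.ofReal (u x)) =ᵐ[volume] fun x =>
      ∫⁻ y, ENNReal.ofReal (‖x - y‖ ^ (-((Module.finrank ℝ E : ℝ) - 2 * s)) *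
        (c * ‖y‖ ^ α * u y ^ p)) := by
  obtain ⟨c, hc, hheat⟩ := hu.integral_mul_heat hs0 hs1 hU hF
  obtain ⟨C, hC0, hC⟩ := exists_lintegral_rpow_mul_heat (E := E) hns
  have hum := hu.measurable
  have hfm : Measurable fun y => ‖y‖ ^ α * u y ^ p := by fun_prop
  have hU' : ∫⁻ x, ‖u x‖ₑ * ENNReal.ofReal ((max 1 ‖x‖) ^ (-(Module.finrank ℝ E : ℝ))) < ⊤ := by
    refine lt_of_eq_of_lt (lintegral_congr_ae ?_) hU
    filter_upwards [hu.pos] with y hy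
    rw [Real.enorm_of_nonneg hy.le]
  have hleft : ∀ x₀ : E, ∫⁻ x, ENNReal.ofReal (heat 1 (x₀ - x)) * ENNReal.ofReal (u x) =
      ∫⁻ x, ENNReal.ofReal (u x * heat 1 (x₀ - x)) := fun x₀ => by
    refine lintegral_congr fun x => ?_
    rw [ENNReal.ofReal_mul' (heat_pos one_pos _).le, mul_comm]
  refine ⟨c * C, mul_pos hc hC0, ae_eq_of_lintegral_heat_mul hum.ennreal_ofReal ?_ (fun x₀ => ?_)
    fun x₀ => ?_⟩
  · refine Measurable.lintegral_prod_right' (f := fun w : E × E => ENNReal.ofReal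
      (‖w.1 - w.2‖ ^ (-((Module.finrank ℝ E : ℝ) - 2 * s)) * (c * C * ‖w.2‖ ^ α * u w.2 ^ p))) ?_
    fun_prop
  · rw [hleft]
    obtain ⟨φ, hφ⟩ := exists_schwartzMap_heat one_pos x₀
    have := integrable_mul_schwartzMap hum.aestronglyMeasurable hU' φ
    simp only [hφ] at this
    exact this.lintegral_lt_top
  · rw [hleft, hheat, lintegral_lintegral_heat_eq hfm hC0 hC,
      ← lintegral_const_mul' _ _ ENNReal.ofReal_ne_top]
    refine lintegral_congr fun x => ?_
    rw [mul_left_comm, ← lintegral_const_mul' _ _ ENNReal.ofReal_ne_top]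
    congr 1
    refine lintegral_congr fun y => ?_
    rw [← ENNReal.ofReal_mul hc.le, neg_sub]
    congr 1
    ring

end RieszPotential

section Contradiction

open scoped Topology

variable {E : Type*} [NormedAddCommGroup E] [InnerProductSpace ℝ E] [FiniteDimensional ℝ E]
  [MeasurableSpace E] [BorelSpace E]

theorem lowerSemicontinuous_rieszPotential [Nontrivial E] {q : ℝ} {f : E → ℝ} (hf : Measurable f) :
    LowerSemicontinuous fun x => ∫⁻ y, ENNReal.ofReal (‖x - y‖ ^ (-q) * f y) := by
  rw [lowerSemicontinuous_iff_le_liminf]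
  intro x
  refine le_trans ?_ (lintegral_liminf_le fun x' => ?_)
  · refine lintegral_mono_ae ?_
    filter_upwards [compl_mem_ae_iff.2 (measure_singleton x)] with y hy
    have hxy : ‖x - y‖ ≠ 0 := norm_ne_zero_iff.2 (sub_ne_zero.2 fun h => hy h.symm)
    have hc : ContinuousAt (fun x' => ENNReal.ofReal (‖x' - y‖ ^ (-q) * f y)) x := by
      refine ENNReal.continuous_ofReal.continuousAt.comp ?_
      refine ContinuousAt.mul ?_ continuousAt_const
      exact ContinuousAt.rpow_const (by fun_prop) (Or.inl hxy)
    exact hc.tendsto.liminf_eq.ge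
  · fun_prop

theorem ae_le_const_of_lsc {V : E → ENNReal} (hV : LowerSemicontinuous V) {R C : ℝ}
    (h : ∀ᵐ x, ‖x‖ < R → V x ≤ ENNReal.ofReal C) (x : E) (hx : ‖x‖ < R) :
    V x ≤ ENNReal.ofReal C := by
  by_contra! hlt
  have hopen : IsOpen (Metric.ball (0 : E) R ∩ V ⁻¹' Ioi (ENNReal.ofReal C)) :=
    Metric.isOpen_ball.inter (hV.isOpen_preimage _)
  have hpos := hopen.measure_pos volume ⟨x, by simpa using hx, hlt⟩
  refine hpos.ne' (measure_mono_null ?_ h)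
  rintro y ⟨hy1, hy2⟩ hy
  exact absurd (hy (by simpa using hy1)) (not_le.2 hy2)

variable {s α p : ℝ} {u : E → ℝ}

theorem IsSolution.exists_isPotential [Nontrivial E] (hu : IsSolution s α p u)
    (hs0 : 0 < s) (hs1 : s < 1) (hns : 2 * s < (Module.finrank ℝ E : ℝ))
    (hU : ∫⁻ x, ENNReal.ofReal (u x) *
      ENNReal.ofReal ((max 1 ‖x‖) ^ (-(Module.finrank ℝ E : ℝ))) < ⊤)
    (hF : ∫⁻ x, ENNReal.ofReal (‖x‖ ^ α * u x ^ p) *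
      ENNReal.ofReal ((max 1 ‖x‖) ^ (-(Module.finrank ℝ E : ℝ))) < ⊤) :
    ∃ c v, 0 < c ∧ IsPotential ((Module.finrank ℝ E : ℝ) - 2 * s) α p c v ∧ u =ᵐ[volume] v := by
  obtain ⟨c, hc, hae⟩ := hu.exists_ae_eq_rieszPotential hs0 hs1 hns hU hF
  have hum := hu.measurable
  have hfm : Measurable fun y => c * ‖y‖ ^ α * u y ^ p := by fun_prop
  set V : E → ENNReal := fun x =>
    ∫⁻ y, ENNReal.ofReal (‖x - y‖ ^ (-((Module.finrank ℝ E : ℝ) - 2 * s)) *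
      (c * ‖y‖ ^ α * u y ^ p)) with hVdef
  have hVl : LowerSemicontinuous V := lowerSemicontinuous_rieszPotential hfm
  have hVb : ∀ R : ℝ, ∃ C : ℝ, ∀ x, ‖x‖ < R → V x ≤ ENNReal.ofReal C := by
    intro R
    obtain ⟨C, hC⟩ := hu.bdd R
    refine ⟨C, ae_le_const_of_lsc hVl ?_⟩
    filter_upwards [hae] with x hx hxR
    rw [← hx]
    exact ENNReal.ofReal_le_ofReal ((le_abs_self _).trans (hC x hxR.le))
  have hVtop : ∀ x, V x ≠ ⊤ := fun x => by
    obtain ⟨C, hC⟩ := hVb (‖x‖ + 1)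
    exact ne_top_of_le_ne_top ENNReal.ofReal_ne_top (hC x (by linarith))
  have hVpos : ∀ x, 0 < V x := by
    intro x
    rw [pos_iff_ne_zero]
    intro h0
    rw [hVdef, lintegral_eq_zero_iff (by fun_prop)] at h0
    have : ∀ᵐ y : E, False := by
      filter_upwards [h0, hu.pos, compl_mem_ae_iff.2 (measure_singleton x),
        compl_mem_ae_iff.2 (measure_singleton (0 : E))] with y h1 h2 h3 h4
      have h5 : 0 < ‖x - y‖ := norm_pos_iff.2 (sub_ne_zero.2 fun h => h3 h.symm)
      have h6 : 0 < ‖y‖ := norm_pos_iff.2 h4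
      simp only [Pi.zero_apply, ENNReal.ofReal_eq_zero] at h1
      have : 0 < ‖x - y‖ ^ (-((Module.finrank ℝ E : ℝ) - 2 * s)) * (c * ‖y‖ ^ α * u y ^ p) := by
        positivity
      linarith
    obtain ⟨y, hy⟩ := this.exists
    exact hy
  have huv : u =ᵐ[volume] fun x => (V x).toReal := by
    filter_upwards [hae, hu.pos] with x hx hx0
    rw [← ENNReal.toReal_ofReal hx0.le, hx]
  refine ⟨c, fun x => (V x).toReal, hc, ⟨fun x => ENNReal.toReal_pos (hVpos x).ne' (hVtop x),
    hVl.measurable.ennreal_toReal, ?_, fun R => ?_, fun x => ?_⟩, huv⟩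
  · intro x a ha
    by_cases ha0 : a < 0
    · exact Eventually.of_forall fun y => ha0.trans_le ENNReal.toReal_nonneg
    · have := hVl x (ENNReal.ofReal a) ((ENNReal.ofReal_lt_iff_lt_toReal (not_lt.1 ha0) (hVtop x)).2 ha)
      filter_upwards [this] with y hy
      exact (ENNReal.ofReal_lt_iff_lt_toReal (not_lt.1 ha0) (hVtop y)).1 hy
  · obtain ⟨C, hC⟩ := hVb (R + 1)
    refine ⟨max C 0, fun x hx => ?_⟩
    refine (ENNReal.toReal_mono ENNReal.ofReal_ne_top (hC x (by linarith))).trans ?_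
    rw [ENNReal.toReal_ofReal']
  · rw [ENNReal.ofReal_toReal (hVtop x)]
    refine lintegral_congr_ae ?_
    filter_upwards [huv] with y hy
    rw [hy]

theorem not_isSolution [Nontrivial E] (hs0 : 0 < s) (hs1 : s < 1)
    (hns : 2 * s < (Module.finrank ℝ E : ℝ)) (hα : -2 * s < α) (hp : 1 < p)
    (hp2 : p < ((Module.finrank ℝ E : ℝ) + 2 * α + 2 * s) / (Module.finrank ℝ E - 2 * s)) :
    ¬ IsSolution s α p u := by
  intro hu
  obtain ⟨μ, C, hμ, hC, hball⟩ := hu.exists_lintegral_ball_le hs0 hs1 hns hp hp2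
  have hum := hu.measurable
  have hμ0 : 0 < μ := by linarith
  have hU := lintegral_mul_weight_lt_top volume (hum.ennreal_ofReal) (by linarith) hμ0
    fun R hR => (hball R hR).1
  have hF := lintegral_mul_weight_lt_top volume
    (show Measurable fun x => ENNReal.ofReal (‖x‖ ^ α * u x ^ p) by fun_prop) (by linarith) hμ0
    fun R hR => (hball R hR).2
  obtain ⟨c, v, hc, hv, huv⟩ := hu.exists_isPotential hs0 hs1 hns hU hF
  have hn0 : 0 < (Module.finrank ℝ E : ℝ) - 2 * s := by linarith
  rw [lt_div_iff₀ hn0] at hp2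
  obtain ⟨m, hm, hlow⟩ := hv.exists_rpow_le rfl hn0 (by linarith) (by linarith) hp
    (by linarith) hc
  set n : ℝ := (Module.finrank ℝ E : ℝ)
  set k := (n - 2 * s) / 2
  have hvol : 0 < volume.real (Metric.ball (0 : E) 1) :=
    ENNReal.toReal_pos (Metric.measure_ball_pos _ _ one_pos).ne' measure_ball_lt_top.ne
  set b := volume.real (Metric.ball (0 : E) 1)
  have hk0 : 0 < k := by simp only [k]; linarith
  have key : ∀ R : ℝ, 2 ≤ R → m * R ^ (-k) * ((R ^ n - 2 ^ n) * b) ≤ C * R ^ (n - μ) := by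
    intro R hR
    have hR0 : 0 < R := by linarith
    have hvolR : ∀ r : ℝ, 0 < r → volume (Metric.ball (0 : E) r) = ENNReal.ofReal (r ^ n * b) := by
      intro r hr
      rw [Measure.addHaar_ball _ _ hr.le, ENNReal.ofReal_mul (by positivity),
        ofReal_measureReal measure_ball_lt_top.ne, Real.rpow_natCast]
    have h1 : ENNReal.ofReal (m * R ^ (-k)) *
        volume (Metric.ball (0 : E) R \ Metric.ball 0 2) ≤
        ∫⁻ x in Metric.ball (0 : E) R, ENNReal.ofReal (u x) := by
      rw [← setLIntegral_const]
      refine le_trans (setLIntegral_mono_ae' (measurableSet_ball.diff measurableSet_ball) ?_)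
        (lintegral_mono_set sdiff_subset)
      filter_upwards [huv] with x hx hxR
      simp only [Set.mem_sdiff, Metric.mem_ball, dist_zero_right, not_lt] at hxR
      rw [hx]
      refine ENNReal.ofReal_le_ofReal (le_trans ?_ (hlow x (by linarith)))
      refine mul_le_mul_of_nonneg_left ?_ hm.le
      exact Real.rpow_le_rpow_of_nonpos (by linarith) hxR.1.le (by linarith)
    have h2 := h1.trans (hball R (by linarith)).1
    rw [measure_sdiff (Metric.ball_subset_ball hR) measurableSet_ball.nullMeasurableSet
      measure_ball_lt_top.ne, hvolR R hR0, hvolR 2 two_pos, ← ENNReal.ofReal_sub _ (by positivity),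
      ← ENNReal.ofReal_mul (by positivity), ENNReal.ofReal_le_ofReal_iff (by positivity)] at h2
    rw [sub_mul]
    exact h2
  have key2 : ∀ R : ℝ, 2 ≤ R → m * b ≤ C * R ^ (k - μ) + m * b * 2 ^ n * R ^ (-n) := by
    intro R hR
    have hR0 : 0 < R := by linarith
    have h := mul_le_mul_of_nonneg_left (key R hR) (show 0 ≤ R ^ (k - n) by positivity)
    have e1 : R ^ (k - n) * R ^ (n - μ) = R ^ (k - μ) := by
      rw [← Real.rpow_add hR0]; congr 1; ring
    have e2 : R ^ (k - n) * R ^ (-k) = R ^ (-n) := by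
      rw [← Real.rpow_add hR0]; congr 1; ring
    have e3 : R ^ (-n) * R ^ n = 1 := by
      rw [← Real.rpow_add hR0]; simp
    have h4 : R ^ (k - n) * (m * R ^ (-k) * ((R ^ n - 2 ^ n) * b)) =
        m * b - m * b * 2 ^ n * R ^ (-n) := by
      linear_combination m * ((R ^ n - 2 ^ n) * b) * e2 + m * b * e3
    have h5 : R ^ (k - n) * (C * R ^ (n - μ)) = C * R ^ (k - μ) := by
      linear_combination C * e1
    linarith
  have hn : 0 < n := by linarith
  have hlim : Tendsto (fun R : ℝ => C * R ^ (k - μ) + m * b * 2 ^ n * R ^ (-n)) atTop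
      (𝓝 (C * 0 + m * b * 2 ^ n * 0)) := by
    refine Tendsto.add (Tendsto.const_mul _ ?_) (Tendsto.const_mul _ (tendsto_rpow_neg_atTop hn))
    have := tendsto_rpow_neg_atTop (show 0 < μ - k by linarith)
    rwa [neg_sub] at this
  have := ge_of_tendsto hlim (eventually_atTop.2 ⟨2, key2⟩)
  have : 0 < m * b := by positivity
  linarith

end Contradiction

end FracHenon

/-- **Liouville theorem for the nonlocal Hénon equation** (Theorem 1.1).
Let `N ≥ 1`, `0 < s < 1` with `N > 2s`, `α > -2s` and `1 < p < (N + 2α + 2s)/(N - 2s)`.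
Then there is no measurable, a.e. positive, locally bounded function `u ∈ L_{2s}` with
`|x|^α u^p` locally integrable which solves `(-Δ)^s u = |x|^α u^p` in the distributional
sense. -/
theorem no_positive_distributional_solution_subcritical
    (N : ℕ) (hN : 0 < N) (s α p : ℝ) (hs0 : 0 < s) (hs1 : s < 1)
    (hNs : 2 * s < (N : ℝ)) (hα : -2 * s < α) (hp1 : 1 < p)
    (hp2 : p < ((N : ℝ) + 2 * α + 2 * s) / ((N : ℝ) - 2 * s)) :
    ¬ ∃ u : EuclideanSpace ℝ (Fin N) → ℝ,
        Measurable u ∧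
        (∀ᵐ x : EuclideanSpace ℝ (Fin N), 0 < u x) ∧
        (∀ R : ℝ, ∃ C : ℝ, ∀ x : EuclideanSpace ℝ (Fin N), ‖x‖ ≤ R → |u x| ≤ C) ∧
        Integrable (fun y : EuclideanSpace ℝ (Fin N) =>
          |u y| / (1 + ‖y‖ ^ ((N : ℝ) + 2 * s))) ∧
        LocallyIntegrable (fun x : EuclideanSpace ℝ (Fin N) => ‖x‖ ^ α * u x ^ p) ∧
        (∀ φ : SchwartzMap (EuclideanSpace ℝ (Fin N)) ℝ,
          ∫ x : EuclideanSpace ℝ (Fin N), u x *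
              ((1 / 2) * ∫ z : EuclideanSpace ℝ (Fin N),
                (2 * φ x - φ (x + z) - φ (x - z)) / ‖z‖ ^ ((N : ℝ) + 2 * s)) =
            ∫ x : EuclideanSpace ℝ (Fin N), ‖x‖ ^ α * u x ^ p * φ x) := by
  rintro ⟨u, hmeas, hpos, hbdd, -, hloc, hweak⟩
  have : Nonempty (Fin N) := ⟨⟨0, hN⟩⟩
  have hfin : (Module.finrank ℝ (EuclideanSpace ℝ (Fin N)) : ℝ) = N := by simp
  refine FracHenon.not_isSolution hs0 hs1 (by rwa [hfin]) hα hp1 (by rwa [hfin])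
    ⟨hmeas, hpos, hbdd, hloc, fun φ => ?_⟩
  simp only [FracHenon.fracLap, hfin]
  exact hweak φ
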